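/- Let k > 2, let R̃ ∈ F^{(k−1)n×(k−1)n} be nonsingular, and let B(λ) = λ[0_{(k−1)n×n} −R̃] + [R̃ 0_{(k−1)n×n}]. If ΔB(λ) ∈ F[λ]^{(k−1)n×kn} is any pencil with ‖ΔB‖_F < σ_min(R̃)/(2k^{3/2}), then there exists a matrix polynomial ΔD(λ) ∈ F[λ]^{kn×n} of grade k−1 such that: (a) B(λ)+ΔB(λ) and (Λ_k(λ)⊗I_n)^T + ΔD(λ)^T are dual minimal bases with all row degrees equal to 1 and k−1 respectively; and (b) ‖ΔD‖_F ≤ (k√2/σ_min(R̃))‖ΔB‖_F < 1/√(2k). -/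

import Mathlib

noncomputable section

open Polynomial Matrix

namespace GLin

variable {F : Type*} [RCLike F]

/-! ### Matrix polynomials and pencils -/

/-- The matrix polynomial `P(λ) = ∑_{i=0}^k λ^i A_i` determined by its
coefficient matrices `A_0, …, A_k` (grade `k`). -/
def matPoly {k m n : ℕ} (A : Fin (k + 1) → Matrix (Fin m) (Fin n) F) :
    Matrix (Fin m) (Fin n) F[X] :=
  Matrix.of fun r c => ∑ i : Fin (k + 1), Polynomial.C (A i r c) * Polynomial.X ^ (i : ℕ)

/-- The matrix pencil `L(λ) = λ X + Y`. -/
def pencil {ρ γ : Type*} (Xc Yc : Matrix ρ γ F) : Matrix ρ γ F[X] :=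
  Matrix.of fun i j => Polynomial.C (Xc i j) * Polynomial.X + Polynomial.C (Yc i j)

/-- `Λ_k(λ) ⊗ I_n` where `Λ_k(λ) = (λ^{k-1}, …, λ, 1)ᵀ`. -/
def Lam (F : Type*) [RCLike F] (k n : ℕ) : Matrix (Fin k × Fin n) (Fin n) F[X] :=
  Matrix.of fun p c => if p.2 = c then Polynomial.X ^ (k - 1 - (p.1 : ℕ)) else 0

/-- `Λ_k(λ)ᵀ ⊗ I_m`. -/
def LamRow (F : Type*) [RCLike F] (k m : ℕ) : Matrix (Fin m) (Fin k × Fin m) F[X] :=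
  Matrix.of fun r p => if r = p.2 then Polynomial.X ^ (k - 1 - (p.1 : ℕ)) else 0

/-- `v ⊗ P(λ)`. -/
def vkron {k m n : ℕ} (v : Fin k → F) (P : Matrix (Fin m) (Fin n) F[X]) :
    Matrix (Fin k × Fin m) (Fin n) F[X] :=
  Matrix.of fun p c => Polynomial.C (v p.1) * P p.2 c

/-- `wᵀ ⊗ P(λ)`. -/
def wkron {k m n : ℕ} (w : Fin k → F) (P : Matrix (Fin m) (Fin n) F[X]) :
    Matrix (Fin m) (Fin k × Fin n) F[X] :=
  Matrix.of fun r q => Polynomial.C (w q.1) * P r q.2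

/-- The defining identity of `𝕃₁(P)`: `L(λ)(Λ_k(λ) ⊗ I_n) = v ⊗ P(λ)`. -/
def RightAnsatz {k m n : ℕ} (P : Matrix (Fin m) (Fin n) F[X])
    (L : Matrix (Fin k × Fin m) (Fin k × Fin n) F[X]) (v : Fin k → F) : Prop :=
  L * Lam F k n = vkron v P

/-- The defining identity of `𝕃₂(P)`: `(Λ_k(λ)ᵀ ⊗ I_m) L(λ) = wᵀ ⊗ P(λ)`. -/
def LeftAnsatz {k m n : ℕ} (P : Matrix (Fin m) (Fin n) F[X])
    (L : Matrix (Fin k × Fin m) (Fin k × Fin n) F[X]) (w : Fin k → F) : Prop :=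
  LamRow F k m * L = wkron w P

/-- The vector `α e₁ ∈ F^k`. -/
def e1 {k : ℕ} (α : F) : Fin k → F := fun i => if (i : ℕ) = 0 then α else 0

/-- `M ⊗ I_m`. -/
def kronId {k m : ℕ} (M : Matrix (Fin k) (Fin k) F) :
    Matrix (Fin k × Fin m) (Fin k × Fin m) F :=
  Matrix.of fun p q => if p.2 = q.2 then M p.1 q.1 else 0

/-! ### (strong) g-linearizations -/

/-- `diag(P(λ), I_{k-1} ⊗ I_{m,n})`. -/
def glinTarget {k m n : ℕ} (P : Matrix (Fin m) (Fin n) F[X]) :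
    Matrix (Fin k × Fin m) (Fin k × Fin n) F[X] :=
  Matrix.of fun p q =>
    if p.1 = q.1 then
      (if (p.1 : ℕ) = 0 then P p.2 q.2 else if (p.2 : ℕ) = (q.2 : ℕ) then 1 else 0)
    else 0

/-- A `km × kn` pencil (or matrix polynomial) `L` is a g-linearization of the `m × n`
matrix polynomial `P` of grade `k` if `E(λ) L(λ) G(λ) = diag(P(λ), I_{k-1} ⊗ I_{m,n})`
for unimodular `E`, `G`. -/
def IsGLin {k m n : ℕ} (P : Matrix (Fin m) (Fin n) F[X])
    (L : Matrix (Fin k × Fin m) (Fin k × Fin n) F[X]) : Prop :=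
  ∃ (E : Matrix (Fin k × Fin m) (Fin k × Fin m) F[X])
    (G : Matrix (Fin k × Fin n) (Fin k × Fin n) F[X]),
      IsUnit E.det ∧ IsUnit G.det ∧ E * L * G = glinTarget P

/-- grade-`N` reversal `rev_N P(λ) = λ^N P(1/λ)`, entrywise. -/
def revMat {ρ γ : Type*} (N : ℕ) (P : Matrix ρ γ F[X]) : Matrix ρ γ F[X] :=
  P.map fun p => Polynomial.reflect N p

/-- Strong g-linearization of the grade-`k` matrix polynomial with coefficients `A`. -/
def IsStrongGLin {k m n : ℕ} (A : Fin (k + 1) → Matrix (Fin m) (Fin n) F)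
    (L : Matrix (Fin k × Fin m) (Fin k × Fin n) F[X]) : Prop :=
  IsGLin (matPoly A) L ∧ IsGLin (revMat k (matPoly A)) (revMat 1 L)

/-! ### linearizations (rectangular, of size `(m+s) × (n+s)`) -/

/-- A matrix polynomial `L` (indexed by arbitrary finite types of cardinalities
`m + s` and `n + s`) is a linearization of `P` if, after identifying the index types
with `Fin m ⊕ Fin s` and `Fin n ⊕ Fin s`, one has `E(λ) L(λ) G(λ) = diag(P(λ), I_s)`
for unimodular `E`, `G`. -/
def IsLin {m n : ℕ} (s : ℕ) (P : Matrix (Fin m) (Fin n) F[X])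
    {ρ γ : Type*} [Fintype ρ] [DecidableEq ρ] [Fintype γ] [DecidableEq γ]
    (L : Matrix ρ γ F[X]) : Prop :=
  ∃ (er : ρ ≃ (Fin m ⊕ Fin s)) (ec : γ ≃ (Fin n ⊕ Fin s))
    (E : Matrix (Fin m ⊕ Fin s) (Fin m ⊕ Fin s) F[X])
    (G : Matrix (Fin n ⊕ Fin s) (Fin n ⊕ Fin s) F[X]),
      IsUnit E.det ∧ IsUnit G.det ∧
        E * Matrix.reindex er ec L * G = Matrix.fromBlocks P 0 0 1

/-- Strong linearization of the grade-`k` matrix polynomial with coefficients `A`. -/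
def IsStrongLin {k m n : ℕ} (s : ℕ) (A : Fin (k + 1) → Matrix (Fin m) (Fin n) F)
    {ρ γ : Type*} [Fintype ρ] [DecidableEq ρ] [Fintype γ] [DecidableEq γ]
    (L : Matrix ρ γ F[X]) : Prop :=
  IsLin s (matPoly A) L ∧ IsLin s (revMat k (matPoly A)) (revMat 1 L)

/-! ### shifted sums -/

/-- Column shifted sum `X ⊞→ Y`. -/
def colShiftSum {k m n : ℕ} (Xc Yc : Matrix (Fin k × Fin m) (Fin k × Fin n) F) :
    Matrix (Fin k × Fin m) (Fin (k + 1) × Fin n) F :=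
  Matrix.of fun p q =>
    (if h : (q.1 : ℕ) < k then Xc p (⟨(q.1 : ℕ), h⟩, q.2) else 0) +
    (if h : 0 < (q.1 : ℕ) then
        Yc p (⟨(q.1 : ℕ) - 1, by have := q.1.isLt; omega⟩, q.2)
      else 0)

/-- Row shifted sum `X ⊞↓ Y`. -/
def rowShiftSum {k m n : ℕ} (Xc Yc : Matrix (Fin k × Fin m) (Fin k × Fin n) F) :
    Matrix (Fin (k + 1) × Fin m) (Fin k × Fin n) F :=
  Matrix.of fun p q =>
    (if h : (p.1 : ℕ) < k then Xc (⟨(p.1 : ℕ), h⟩, p.2) q else 0) +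
    (if h : 0 < (p.1 : ℕ) then
        Yc (⟨(p.1 : ℕ) - 1, by have := p.1.isLt; omega⟩, p.2) q
      else 0)

/-! ### the parametrization of `𝕃₁(P)` and `𝕃₂(P)` -/

/-- `X = [v ⊗ A_k ∣ -W]`. -/
def L1X {k m n : ℕ} (A : Fin (k + 1) → Matrix (Fin m) (Fin n) F) (v : Fin k → F)
    (W : Matrix (Fin k × Fin m) (Fin (k - 1) × Fin n) F) :
    Matrix (Fin k × Fin m) (Fin k × Fin n) F :=
  Matrix.of fun p q =>
    if h : (q.1 : ℕ) = 0 then v p.1 * A (Fin.last k) p.2 q.2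
    else -W p (⟨(q.1 : ℕ) - 1, by have := q.1.isLt; omega⟩, q.2)

/-- `Y = [W + v ⊗ [A_{k-1} ⋯ A_1] ∣ v ⊗ A_0]`. -/
def L1Y {k m n : ℕ} (A : Fin (k + 1) → Matrix (Fin m) (Fin n) F) (v : Fin k → F)
    (W : Matrix (Fin k × Fin m) (Fin (k - 1) × Fin n) F) :
    Matrix (Fin k × Fin m) (Fin k × Fin n) F :=
  Matrix.of fun p q =>
    if h : (q.1 : ℕ) < k - 1 then
      W p (⟨(q.1 : ℕ), h⟩, q.2) + v p.1 * A (⟨k - 1 - (q.1 : ℕ), by omega⟩) p.2 q.2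
    else v p.1 * A 0 p.2 q.2

/-- `X = [wᵀ ⊗ A_k ; -Ŵ]`. -/
def L2X {k m n : ℕ} (A : Fin (k + 1) → Matrix (Fin m) (Fin n) F) (w : Fin k → F)
    (W : Matrix (Fin (k - 1) × Fin m) (Fin k × Fin n) F) :
    Matrix (Fin k × Fin m) (Fin k × Fin n) F :=
  Matrix.of fun p q =>
    if h : (p.1 : ℕ) = 0 then w q.1 * A (Fin.last k) p.2 q.2
    else -W (⟨(p.1 : ℕ) - 1, by have := p.1.isLt; omega⟩, p.2) q

/-- `Y = [Ŵ + wᵀ ⊗ [A_{k-1}ᵀ ⋯ A_1ᵀ]ᵀ ; wᵀ ⊗ A_0]`. -/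
def L2Y {k m n : ℕ} (A : Fin (k + 1) → Matrix (Fin m) (Fin n) F) (w : Fin k → F)
    (W : Matrix (Fin (k - 1) × Fin m) (Fin k × Fin n) F) :
    Matrix (Fin k × Fin m) (Fin k × Fin n) F :=
  Matrix.of fun p q =>
    if h : (p.1 : ℕ) < k - 1 then
      W (⟨(p.1 : ℕ), h⟩, p.2) q + w q.1 * A (⟨k - 1 - (p.1 : ℕ), by omega⟩) p.2 q.2
    else w q.1 * A 0 p.2 q.2

/-! ### block structure and `Z`-matrices -/

/-- Assemble a `km × kn` matrix from blocks with row split `m + (k-1)m` and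
column split `n + (k-1)n`. -/
def blk {k m n : ℕ} (TL : Matrix (Fin m) (Fin n) F)
    (TR : Matrix (Fin m) (Fin (k - 1) × Fin n) F)
    (BL : Matrix (Fin (k - 1) × Fin m) (Fin n) F)
    (BR : Matrix (Fin (k - 1) × Fin m) (Fin (k - 1) × Fin n) F) :
    Matrix (Fin k × Fin m) (Fin k × Fin n) F :=
  Matrix.of fun p q =>
    if hp : (p.1 : ℕ) = 0 then
      if hq : (q.1 : ℕ) = 0 then TL p.2 q.2
      else TR p.2 (⟨(q.1 : ℕ) - 1, by have := q.1.isLt; omega⟩, q.2)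
    else
      if hq : (q.1 : ℕ) = 0 then
        BL (⟨(p.1 : ℕ) - 1, by have := p.1.isLt; omega⟩, p.2) q.2
      else
        BR (⟨(p.1 : ℕ) - 1, by have := p.1.isLt; omega⟩, p.2)
          (⟨(q.1 : ℕ) - 1, by have := q.1.isLt; omega⟩, q.2)

/-- Assemble `[[Y₁₁, T],[Z, 0]]`, row split `m + (k-1)m`, column split `(k-1)n + n`. -/
def blkY1 {k m n : ℕ} (Y11 : Matrix (Fin m) (Fin (k - 1) × Fin n) F)
    (T : Matrix (Fin m) (Fin n) F)
    (Z : Matrix (Fin (k - 1) × Fin m) (Fin (k - 1) × Fin n) F) :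
    Matrix (Fin k × Fin m) (Fin k × Fin n) F :=
  Matrix.of fun p q =>
    if hp : (p.1 : ℕ) = 0 then
      if hq : (q.1 : ℕ) < k - 1 then Y11 p.2 (⟨(q.1 : ℕ), hq⟩, q.2) else T p.2 q.2
    else
      if hq : (q.1 : ℕ) < k - 1 then
        Z (⟨(p.1 : ℕ) - 1, by have := p.1.isLt; omega⟩, p.2) (⟨(q.1 : ℕ), hq⟩, q.2)
      else 0

/-- Assemble `[[Y₁₁, Z],[T, 0]]`, row split `(k-1)m + m`, column split `n + (k-1)n`. -/
def blkY2 {k m n : ℕ} (Y11 : Matrix (Fin (k - 1) × Fin m) (Fin n) F)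
    (Z : Matrix (Fin (k - 1) × Fin m) (Fin (k - 1) × Fin n) F)
    (T : Matrix (Fin m) (Fin n) F) :
    Matrix (Fin k × Fin m) (Fin k × Fin n) F :=
  Matrix.of fun p q =>
    if hp : (p.1 : ℕ) < k - 1 then
      if hq : (q.1 : ℕ) = 0 then Y11 (⟨(p.1 : ℕ), hp⟩, p.2) q.2
      else Z (⟨(p.1 : ℕ), hp⟩, p.2) (⟨(q.1 : ℕ) - 1, by have := q.1.isLt; omega⟩, q.2)
    else
      if hq : (q.1 : ℕ) = 0 then T p.2 q.2 else 0

/-- The `Z`-matrix of `L = λX + Y ∈ 𝕃₁(P)` with respect to `M`: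
the lower-left `(k-1)m × (k-1)n` block of `(M ⊗ I_m) Y`. -/
def Zmat1 {k m n : ℕ} (M : Matrix (Fin k) (Fin k) F)
    (Yc : Matrix (Fin k × Fin m) (Fin k × Fin n) F) :
    Matrix (Fin (k - 1) × Fin m) (Fin (k - 1) × Fin n) F :=
  Matrix.of fun p q =>
    (kronId M * Yc : Matrix (Fin k × Fin m) (Fin k × Fin n) F)
      (⟨(p.1 : ℕ) + 1, by have := p.1.isLt; omega⟩, p.2)
      (⟨(q.1 : ℕ), by have := q.1.isLt; omega⟩, q.2)

/-- The `Z`-matrix of `L = λX + Y ∈ 𝕃₂(P)` with respect to `M̂`: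
the upper-right `(k-1)m × (k-1)n` block of `Y (M̂ᵀ ⊗ I_n)`. -/
def Zmat2 {k m n : ℕ} (M : Matrix (Fin k) (Fin k) F)
    (Yc : Matrix (Fin k × Fin m) (Fin k × Fin n) F) :
    Matrix (Fin (k - 1) × Fin m) (Fin (k - 1) × Fin n) F :=
  Matrix.of fun p q =>
    (Yc * kronId Mᵀ : Matrix (Fin k × Fin m) (Fin k × Fin n) F)
      (⟨(p.1 : ℕ), by have := p.1.isLt; omega⟩, p.2)
      (⟨(q.1 : ℕ) + 1, by have := q.1.isLt; omega⟩, q.2)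

/-- `L = λX + Y ∈ 𝕃₁(P)` with right ansatz vector `v` has full `Z`-rank. -/
def FullZrank1 {k m n : ℕ} (Yc : Matrix (Fin k × Fin m) (Fin k × Fin n) F)
    (v : Fin k → F) : Prop :=
  ∃ (M : Matrix (Fin k) (Fin k) F) (α : F),
    IsUnit M ∧ α ≠ 0 ∧ M.mulVec v = e1 α ∧ (Zmat1 M Yc).rank = (k - 1) * n

/-- `L = λX + Y ∈ 𝕃₂(P)` with left ansatz vector `w` has full `Z`-rank. -/
def FullZrank2 {k m n : ℕ} (Yc : Matrix (Fin k × Fin m) (Fin k × Fin n) F)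
    (w : Fin k → F) : Prop :=
  ∃ (M : Matrix (Fin k) (Fin k) F) (α : F),
    IsUnit M ∧ α ≠ 0 ∧ M.mulVec w = e1 α ∧ (Zmat2 M Yc).rank = (k - 1) * m

/-! ### null spaces, minimal bases and minimal indices over `F(λ)` -/

/-- A matrix polynomial viewed as a matrix over the field of rational functions. -/
def matRF {ρ γ : Type*} (P : Matrix ρ γ F[X]) : Matrix ρ γ (RatFunc F) :=
  P.map (algebraMap F[X] (RatFunc F))

/-- The right null space `N_r(P) = {x(λ) : P(λ) x(λ) ≡ 0}` over `F(λ)`. -/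
def Nr {ρ γ : Type*} [Fintype γ] (P : Matrix ρ γ F[X]) :
    Submodule (RatFunc F) (γ → RatFunc F) :=
  LinearMap.ker (Matrix.mulVecLin (matRF P))

/-- The left null space `N_l(P) = {y(λ) : y(λ)ᵀ P(λ) ≡ 0}` over `F(λ)`. -/
def Nl {ρ γ : Type*} [Fintype ρ] (P : Matrix ρ γ F[X]) :
    Submodule (RatFunc F) (ρ → RatFunc F) :=
  Nr Pᵀ

/-- The normal rank of a matrix polynomial: its rank over `F(λ)`. -/
def nrank {ρ γ : Type*} [Fintype γ] (P : Matrix ρ γ F[X]) : ℕ :=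
  (matRF P).rank

/-- The rational vector determined by a vector polynomial. -/
def polyVec {γ : Type*} (x : γ → F[X]) : γ → RatFunc F :=
  fun i => algebraMap F[X] (RatFunc F) (x i)

/-- A rational vector is a vector polynomial if all its entries are polynomials. -/
def IsVecPoly {γ : Type*} (x : γ → RatFunc F) : Prop :=
  ∃ p : γ → F[X], x = polyVec p

/-- The degree of a vector polynomial: the greatest degree of its components. -/
def polyVecDeg {γ : Type*} [Fintype γ] (x : γ → F[X]) : ℕ :=
  Finset.univ.sup fun i => (x i).natDegree

/-- A polynomial basis of the subspace `V` of `F(λ)^γ`. -/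
def IsPolyBasis {γ ι : Type*} [Fintype γ]
    (V : Submodule (RatFunc F) (γ → RatFunc F)) (b : ι → γ → F[X]) : Prop :=
  LinearIndependent (RatFunc F) (fun i => polyVec (b i)) ∧
    Submodule.span (RatFunc F) (Set.range fun i => polyVec (b i)) = V

/-- A minimal basis of `V`: a polynomial basis of least order (sum of degrees). -/
def IsMinimalBasis {γ ι : Type*} [Fintype γ] [Fintype ι]
    (V : Submodule (RatFunc F) (γ → RatFunc F)) (b : ι → γ → F[X]) : Prop :=
  IsPolyBasis V b ∧
    ∀ (d : ℕ) (b' : Fin d → γ → F[X]), IsPolyBasis V b' →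
      ∑ i, polyVecDeg (b i) ≤ ∑ i, polyVecDeg (b' i)

/-- `ε` is the list of minimal indices of `V`: some minimal basis of `V` has
`ε` as its list of degrees. -/
def HasMinIndices {γ : Type*} [Fintype γ]
    (V : Submodule (RatFunc F) (γ → RatFunc F)) {d : ℕ} (ε : Fin d → ℕ) : Prop :=
  ∃ b : Fin d → γ → F[X], IsMinimalBasis V b ∧ ∀ i, polyVecDeg (b i) = ε i

/-- `Λ_k(λ) ⊗ x(λ)`. -/
def lamTensor {n : ℕ} (k : ℕ) (x : Fin n → RatFunc F) : Fin k × Fin n → RatFunc F :=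
  fun p => algebraMap F[X] (RatFunc F) (Polynomial.X ^ (k - 1 - (p.1 : ℕ))) * x p.2

/-- The matrix `vᵀ ⊗ I_m` over `F(λ)`; `𝓛_v(y) = (vproj v).mulVec y`. -/
def vproj {k m : ℕ} (v : Fin k → F) : Matrix (Fin m) (Fin k × Fin m) (RatFunc F) :=
  Matrix.of fun r p =>
    if r = p.2 then algebraMap F[X] (RatFunc F) (Polynomial.C (v p.1)) else 0

/-- `(vᵀ ⊗ I_m) y` at the level of vector polynomials. -/
def LvPoly {k m : ℕ} (v : Fin k → F) (y : Fin k × Fin m → F[X]) : Fin m → F[X] :=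
  fun r => ∑ i : Fin k, Polynomial.C (v i) * y (i, r)

/-- The rational subspace spanned by the rows of a matrix polynomial. -/
def rowSpan {ρ γ : Type*} [Fintype γ] (B : Matrix ρ γ F[X]) :
    Submodule (RatFunc F) (γ → RatFunc F) :=
  Submodule.span (RatFunc F) (Set.range fun i => polyVec (B i))

/-- A matrix polynomial is a minimal basis if its rows form a minimal basis of the
rational subspace they span. -/
def IsMinimalBasisMat {ρ γ : Type*} [Fintype ρ] [Fintype γ] (B : Matrix ρ γ F[X]) : Prop :=
  IsMinimalBasis (rowSpan B) (fun i => B i)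

/-- Dual minimal bases: `B ∈ F[λ]^{n₁×n}`, `C ∈ F[λ]^{n₂×n}` minimal bases with
`n₁ + n₂ = n` and `B Cᵀ = 0`. -/
def DualMinBases {ρ ρ' γ : Type*} [Fintype ρ] [Fintype ρ'] [Fintype γ]
    (B : Matrix ρ γ F[X]) (Cm : Matrix ρ' γ F[X]) : Prop :=
  IsMinimalBasisMat B ∧ IsMinimalBasisMat Cm ∧
    Fintype.card ρ + Fintype.card ρ' = Fintype.card γ ∧ B * Cmᵀ = 0

/-! ### norms, singular values -/

/-- Square of the Frobenius norm of a constant matrix. -/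
def frobSq {ρ γ : Type*} [Fintype ρ] [Fintype γ] (Ac : Matrix ρ γ F) : ℝ :=
  ∑ i, ∑ j, ‖Ac i j‖ ^ 2

/-- `‖λX + Y‖_F = sqrt(‖X‖_F² + ‖Y‖_F²)`. -/
def penFrob {ρ γ : Type*} [Fintype ρ] [Fintype γ] (Xc Yc : Matrix ρ γ F) : ℝ :=
  Real.sqrt (frobSq Xc + frobSq Yc)

/-- `‖P‖_F = sqrt(∑ ‖A_i‖_F²)` for `P(λ) = ∑ λ^i A_i`. -/
def famFrob {k m n : ℕ} (A : Fin (k + 1) → Matrix (Fin m) (Fin n) F) : ℝ :=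
  Real.sqrt (∑ i, frobSq (A i))

/-- `‖P‖_F` for a matrix polynomial of grade `g`. -/
def mpolyFrob {ρ γ : Type*} [Fintype ρ] [Fintype γ] (g : ℕ) (P : Matrix ρ γ F[X]) : ℝ :=
  Real.sqrt (∑ i, ∑ j, ∑ d ∈ Finset.range (g + 1), ‖(P i j).coeff d‖ ^ 2)

/-- Square of the Euclidean norm of a vector. -/
def vecNormSq {ι : Type*} [Fintype ι] (x : ι → F) : ℝ := ∑ i, ‖x i‖ ^ 2

/-- The smallest singular value of a matrix. -/
def sigmaMin {ρ γ : Type*} [Fintype ρ] [Fintype γ] (Ac : Matrix ρ γ F) : ℝ :=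
  if Fintype.card γ ≤ Fintype.card ρ then
    sInf {r : ℝ | ∃ x : γ → F, vecNormSq x = 1 ∧ r = Real.sqrt (vecNormSq (Ac.mulVec x))}
  else
    sInf {r : ℝ | ∃ y : ρ → F, vecNormSq y = 1 ∧ r = Real.sqrt (vecNormSq (Acᴴ.mulVec y))}

/-- The spectral norm (2-norm) of a matrix. -/
def norm2 {ρ γ : Type*} [Fintype ρ] [Fintype γ] (Ac : Matrix ρ γ F) : ℝ :=
  sSup {r : ℝ | ∃ x : γ → F, vecNormSq x = 1 ∧ r = Real.sqrt (vecNormSq (Ac.mulVec x))}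

/-- `κ₂(D) = ‖D‖₂ ‖D⁻¹‖₂`. -/
def cond2 {ρ : Type*} [Fintype ρ] [DecidableEq ρ] (Dc : Matrix ρ ρ F) : ℝ :=
  norm2 Dc * norm2 Dc⁻¹

/-! ### pencils used in the backward error analysis -/

/-- `B(λ) = λ [0 ∣ -R̃] + [R̃ ∣ 0]`, i.e. `R̃ (H_{k-1}(λ) ⊗ I_n)` up to sign conventions. -/
def Bpencil {k n : ℕ} (R : Matrix (Fin (k - 1) × Fin n) (Fin (k - 1) × Fin n) F) :
    Matrix (Fin (k - 1) × Fin n) (Fin k × Fin n) F[X] :=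
  Matrix.of fun p q =>
    (if h : (q.1 : ℕ) < k - 1 then Polynomial.C (R p (⟨(q.1 : ℕ), h⟩, q.2)) else 0) +
    (if h : 0 < (q.1 : ℕ) then
        Polynomial.X *
          Polynomial.C (-R p (⟨(q.1 : ℕ) - 1, by have := q.1.isLt; omega⟩, q.2))
      else 0)

/-- The coefficient of `λ` in `H_{k-1}(λ) ⊗ I_n`. -/
def Hlam (F : Type*) [RCLike F] (k n : ℕ) :
    Matrix (Fin (k - 1) × Fin n) (Fin k × Fin n) F :=
  Matrix.of fun p q => if p.2 = q.2 ∧ (q.1 : ℕ) = (p.1 : ℕ) + 1 then 1 else 0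

/-- The constant coefficient of `H_{k-1}(λ) ⊗ I_n`. -/
def Hconst (F : Type*) [RCLike F] (k n : ℕ) :
    Matrix (Fin (k - 1) × Fin n) (Fin k × Fin n) F :=
  Matrix.of fun p q => if p.2 = q.2 ∧ (q.1 : ℕ) = (p.1 : ℕ) then -1 else 0

/-- The convolution matrix `C_j(λ Xc + Yc)` of a pencil, with `j+1` block columns. -/
def convPencil {ρ γ : Type*} (Xc Yc : Matrix ρ γ F) (j : ℕ) :
    Matrix (Fin (j + 2) × ρ) (Fin (j + 1) × γ) F :=
  Matrix.of fun r c =>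
    if (r.1 : ℕ) = (c.1 : ℕ) then Xc r.2 c.2
    else if (r.1 : ℕ) = (c.1 : ℕ) + 1 then Yc r.2 c.2 else 0

/-- λ-coefficient of the trimmed pencil `L̂_t(λ)`:
`[[α A_k, X₁₂],[0, -R̃]]` with row split `m + (k-1)n`. -/
def LtX {k m n : ℕ} (α : F) (Ak : Matrix (Fin m) (Fin n) F)
    (X12 : Matrix (Fin m) (Fin (k - 1) × Fin n) F)
    (R : Matrix (Fin (k - 1) × Fin n) (Fin (k - 1) × Fin n) F) :
    Matrix (Fin m ⊕ (Fin (k - 1) × Fin n)) (Fin k × Fin n) F :=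
  Matrix.of fun s q =>
    Sum.elim
      (fun r => if h : (q.1 : ℕ) = 0 then α * Ak r q.2
        else X12 r (⟨(q.1 : ℕ) - 1, by have := q.1.isLt; omega⟩, q.2))
      (fun p => if h : (q.1 : ℕ) = 0 then 0
        else -R p (⟨(q.1 : ℕ) - 1, by have := q.1.isLt; omega⟩, q.2)) s

/-- Constant coefficient of the trimmed pencil `L̂_t(λ)`:
`[[Y₁₁, α A₀],[R̃, 0]]` with row split `m + (k-1)n`. -/
def LtY {k m n : ℕ} (α : F) (A0 : Matrix (Fin m) (Fin n) F)
    (Y11 : Matrix (Fin m) (Fin (k - 1) × Fin n) F)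
    (R : Matrix (Fin (k - 1) × Fin n) (Fin (k - 1) × Fin n) F) :
    Matrix (Fin m ⊕ (Fin (k - 1) × Fin n)) (Fin k × Fin n) F :=
  Matrix.of fun s q =>
    Sum.elim
      (fun r => if h : (q.1 : ℕ) < k - 1 then Y11 r (⟨(q.1 : ℕ), h⟩, q.2)
        else α * A0 r q.2)
      (fun p => if h : (q.1 : ℕ) < k - 1 then R p (⟨(q.1 : ℕ), h⟩, q.2) else 0) s

/-! ### trimming -/

/-- The rows `[0 ∣ Q₂*] (M ⊗ I_m)`. -/
def bottomRows {k m n c : ℕ} (M : Matrix (Fin k) (Fin k) F)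
    (Q : Matrix (Fin (k - 1) × Fin m) ((Fin (k - 1) × Fin n) ⊕ Fin c) F) :
    Matrix (Fin c) (Fin k × Fin m) F :=
  (Matrix.of fun (j : Fin c) (p : Fin k × Fin m) =>
      if h : (p.1 : ℕ) = 0 then 0
      else star (Q (⟨(p.1 : ℕ) - 1, by have := p.1.isLt; omega⟩, p.2) (Sum.inr j)))
    * kronId M

/-- The square matrix `[D ; [0 ∣ Q₂*](M ⊗ I_m)]` whose invertibility makes `D` admissible. -/
def trimAux {k m n c : ℕ} (M : Matrix (Fin k) (Fin k) F)
    (Q : Matrix (Fin (k - 1) × Fin m) ((Fin (k - 1) × Fin n) ⊕ Fin c) F)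
    (D : Matrix (Fin m ⊕ (Fin (k - 1) × Fin n)) (Fin k × Fin m) F) :
    Matrix ((Fin m ⊕ (Fin (k - 1) × Fin n)) ⊕ Fin c) (Fin k × Fin m) F :=
  Matrix.of (Sum.elim (fun i j => D i j) (fun i j => bottomRows M Q i j))

/-- The columns `(M̂ᵀ ⊗ I_n) [0 ; Q₂]`. -/
def rightCols {k m n c : ℕ} (M : Matrix (Fin k) (Fin k) F)
    (Q : Matrix (Fin (k - 1) × Fin n) ((Fin (k - 1) × Fin m) ⊕ Fin c) F) :
    Matrix (Fin k × Fin n) (Fin c) F :=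
  kronId Mᵀ *
    (Matrix.of fun (q : Fin k × Fin n) (j : Fin c) =>
      if h : (q.1 : ℕ) = 0 then 0
      else Q (⟨(q.1 : ℕ) - 1, by have := q.1.isLt; omega⟩, q.2) (Sum.inr j))

/-- The square matrix `[D̂ ∣ (M̂ᵀ ⊗ I_n)[0 ; Q₂]]` whose invertibility makes `D̂` admissible. -/
def trimAux2 {k m n c : ℕ} (M : Matrix (Fin k) (Fin k) F)
    (Q : Matrix (Fin (k - 1) × Fin n) ((Fin (k - 1) × Fin m) ⊕ Fin c) F)
    (D : Matrix (Fin k × Fin n) (Fin n ⊕ (Fin (k - 1) × Fin m)) F) :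
    Matrix (Fin k × Fin n) ((Fin n ⊕ (Fin (k - 1) × Fin m)) ⊕ Fin c) F :=
  Matrix.of fun q s => Sum.elim (fun t => D q t) (fun j => rightCols M Q q j) s

/-! ### sums of squares -/

theorem vecNormSq_nonneg {ι : Type*} [Fintype ι] (x : ι → F) : 0 ≤ vecNormSq x :=
  Finset.sum_nonneg fun _ _ => sq_nonneg _

theorem vecNormSq_eq_zero {ι : Type*} [Fintype ι] {x : ι → F} : vecNormSq x = 0 ↔ x = 0 := by
  rw [vecNormSq, Finset.sum_eq_zero_iff_of_nonneg fun _ _ => sq_nonneg _]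
  simp [funext_iff]

theorem vecNormSq_neg {ι : Type*} [Fintype ι] (x : ι → F) : vecNormSq (-x) = vecNormSq x := by
  simp [vecNormSq]

theorem vecNormSq_smul {ι : Type*} [Fintype ι] (a : F) (x : ι → F) :
    vecNormSq (a • x) = ‖a‖ ^ 2 * vecNormSq x := by
  simp [vecNormSq, mul_pow, Finset.mul_sum]

theorem frobSq_nonneg {ρ γ : Type*} [Fintype ρ] [Fintype γ] (A : Matrix ρ γ F) :
    0 ≤ frobSq A :=
  Finset.sum_nonneg fun _ _ => Finset.sum_nonneg fun _ _ => sq_nonneg _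

theorem penFrob_sq {ρ γ : Type*} [Fintype ρ] [Fintype γ] (X Y : Matrix ρ γ F) :
    penFrob X Y ^ 2 = frobSq X + frobSq Y :=
  Real.sq_sqrt (add_nonneg (frobSq_nonneg X) (frobSq_nonneg Y))

theorem frobSq_submatrix_le {ρ γ γ' : Type*} [Fintype ρ] [Fintype γ] [Fintype γ']
    (A : Matrix ρ γ F) {f : γ' → γ} (hf : Function.Injective f) :
    frobSq (A.submatrix id f) ≤ frobSq A := by
  refine Finset.sum_le_sum fun i _ => ?_
  have h : ∑ j, ‖A.submatrix id f i j‖ ^ 2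
      = ∑ j ∈ Finset.univ.map ⟨f, hf⟩, ‖A i j‖ ^ 2 := by simp
  rw [h]
  exact Finset.sum_le_sum_of_subset_of_nonneg (Finset.subset_univ _) fun _ _ _ => sq_nonneg _

theorem vecNormSq_mulVec_le {ρ γ : Type*} [Fintype ρ] [Fintype γ] (A : Matrix ρ γ F)
    (x : γ → F) : vecNormSq (A *ᵥ x) ≤ frobSq A * vecNormSq x := by
  rw [vecNormSq, frobSq, Finset.sum_mul]
  refine Finset.sum_le_sum fun i _ => ?_
  calc ‖(A *ᵥ x) i‖ ^ 2 ≤ (∑ j, ‖A i j‖ * ‖x j‖) ^ 2 := by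
        gcongr
        simpa [Matrix.mulVec, dotProduct] using norm_sum_le Finset.univ fun j => A i j * x j
    _ ≤ _ := Finset.sum_mul_sq_le_sq_mul_sq _ _ _

theorem vecNormSq_mulVec_add_mulVec_le {ρ γ : Type*} [Fintype ρ] [Fintype γ]
    (X Y : Matrix ρ γ F) (x y : γ → F) :
    vecNormSq (Y *ᵥ x + X *ᵥ y) ≤ (frobSq X + frobSq Y) * (vecNormSq x + vecNormSq y) := by
  have h := vecNormSq_mulVec_le (Matrix.fromCols Y X) (Sum.elim x y)
  rw [Matrix.fromCols_mulVec_sumElim] at h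
  have h1 : frobSq (Matrix.fromCols Y X) = frobSq X + frobSq Y := by
    simp [frobSq, Finset.sum_add_distrib, add_comm]
  have h2 : vecNormSq (Sum.elim x y) = vecNormSq x + vecNormSq y := by simp [vecNormSq]
  rwa [h1, h2] at h

theorem sqrt_sum_norm_add_sq_le {ι : Type*} [Fintype ι] (x y : ι → F) :
    √(∑ i, ‖x i + y i‖ ^ 2) ≤ √(∑ i, ‖x i‖ ^ 2) + √(∑ i, ‖y i‖ ^ 2) := by
  have h := norm_add_le (WithLp.toLp 2 x : EuclideanSpace F ι) (WithLp.toLp 2 y)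
  simpa [EuclideanSpace.norm_eq] using h

theorem sigmaMin_nonneg {ρ γ : Type*} [Fintype ρ] [Fintype γ] (A : Matrix ρ γ F) :
    0 ≤ sigmaMin A := by
  unfold sigmaMin
  split_ifs
  all_goals
    refine Real.sInf_nonneg ?_
    rintro r ⟨x, -, rfl⟩
    exact Real.sqrt_nonneg _

theorem sigmaMin_sq_mul_le {ρ : Type*} [Fintype ρ] (R : Matrix ρ ρ F) (x : ρ → F) :
    sigmaMin R ^ 2 * vecNormSq x ≤ vecNormSq (R *ᵥ x) := by
  rcases eq_or_ne x 0 with rfl | hx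
  · simp [vecNormSq]
  have hpos : 0 < vecNormSq x :=
    (vecNormSq_nonneg x).lt_of_ne fun h => hx (vecNormSq_eq_zero.1 h.symm)
  set a : ℝ := (√(vecNormSq x))⁻¹ with ha
  have ha2 : ‖((a : ℝ) : F)‖ ^ 2 = (vecNormSq x)⁻¹ := by
    rw [RCLike.norm_ofReal, sq_abs, ha, inv_pow, Real.sq_sqrt hpos.le]
  have hle : sigmaMin R ≤ √(vecNormSq (R *ᵥ (((a : ℝ) : F) • x))) := by
    rw [sigmaMin, if_pos le_rfl]
    refine csInf_le ⟨0, ?_⟩ ⟨((a : ℝ) : F) • x, ?_, rfl⟩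
    · rintro r ⟨y, -, rfl⟩
      exact Real.sqrt_nonneg _
    · rw [vecNormSq_smul, ha2, inv_mul_cancel₀ hpos.ne']
  have h2 : sigmaMin R ^ 2 ≤ (vecNormSq x)⁻¹ * vecNormSq (R *ᵥ x) := by
    calc sigmaMin R ^ 2 ≤ √(vecNormSq (R *ᵥ (((a : ℝ) : F) • x))) ^ 2 :=
          pow_le_pow_left₀ (sigmaMin_nonneg R) hle 2
      _ = _ := by
          rw [Real.sq_sqrt (vecNormSq_nonneg _), Matrix.mulVec_smul, vecNormSq_smul, ha2]
  calc sigmaMin R ^ 2 * vecNormSq x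
      ≤ ((vecNormSq x)⁻¹ * vecNormSq (R *ᵥ x)) * vecNormSq x := by gcongr
    _ = vecNormSq (R *ᵥ x) := by field_simp

/-- A perturbation that is small in the Frobenius norm preserves nonsingularity. -/
theorem eq_zero_of_add_mulVec_eq_zero {ρ γ : Type*} [Fintype ρ] [Fintype γ]
    {A E : Matrix ρ γ F} {s : ℝ} (hA : ∀ x, s * vecNormSq x ≤ vecNormSq (A *ᵥ x))
    (hE : frobSq E < s) {x : γ → F} (hx : (A + E) *ᵥ x = 0) : x = 0 := by
  rw [Matrix.add_mulVec, add_eq_zero_iff_eq_neg] at hx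
  have h1 := hA x
  rw [hx, vecNormSq_neg] at h1
  have h2 := vecNormSq_mulVec_le E x
  have h3 := vecNormSq_nonneg x
  exact vecNormSq_eq_zero.1 (by nlinarith)

theorem det_add_ne_zero {ρ : Type*} [Fintype ρ] [DecidableEq ρ] {A E : Matrix ρ ρ F} {s : ℝ}
    (hA : ∀ x, s * vecNormSq x ≤ vecNormSq (A *ᵥ x)) (hE : frobSq E < s) :
    (A + E).det ≠ 0 := by
  intro h
  obtain ⟨v, hv, hv0⟩ := Matrix.exists_mulVec_eq_zero_iff.2 h
  exact hv (eq_zero_of_add_mulVec_eq_zero hA hE hv0)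

/-! ### a discrete Poincaré inequality along antidiagonals -/

theorem sum_norm_sq_le_of_zero (x : ℕ → F) (h0 : x 0 = 0) (m : ℕ) :
    ∑ i ∈ Finset.range (m + 1), ‖x i‖ ^ 2
      ≤ ((m : ℝ) + 1) ^ 2 / 2 * ∑ l ∈ Finset.range m, ‖x (l + 1) - x l‖ ^ 2 := by
  set T := ∑ l ∈ Finset.range m, ‖x (l + 1) - x l‖ ^ 2 with hT
  have hT0 : 0 ≤ T := Finset.sum_nonneg fun _ _ => sq_nonneg _
  have key : ∀ i ∈ Finset.range (m + 1), ‖x i‖ ^ 2 ≤ (i : ℝ) * T := by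
    intro i hi
    have hx : x i = ∑ l ∈ Finset.range i, (x (l + 1) - x l) := by
      rw [Finset.sum_range_sub, h0, sub_zero]
    calc ‖x i‖ ^ 2 ≤ (∑ l ∈ Finset.range i, ‖x (l + 1) - x l‖) ^ 2 := by
          gcongr
          conv_lhs => rw [hx]
          exact norm_sum_le _ _
      _ ≤ (Finset.range i).card * ∑ l ∈ Finset.range i, ‖x (l + 1) - x l‖ ^ 2 :=
          sq_sum_le_card_mul_sum_sq
      _ ≤ (i : ℝ) * T := by
          rw [Finset.card_range]
          gcongr
          refine Finset.sum_le_sum_of_subset_of_nonneg ?_ fun _ _ _ => sq_nonneg _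
          exact Finset.range_subset_range.2 (by simpa [Nat.lt_succ_iff] using hi)
  refine (Finset.sum_le_sum key).trans ?_
  rw [← Finset.sum_mul]
  gcongr
  have h := Finset.sum_range_id_mul_two (m + 1)
  have h' : (∑ i ∈ Finset.range (m + 1), (i : ℝ)) * 2 = ((m : ℝ) + 1) * m := by
    have h'' := congrArg (Nat.cast : ℕ → ℝ) h
    simpa using h''
  nlinarith

theorem sum_range_antidiag_eq (f : ℕ → ℕ → ℝ) {p q N : ℕ} (hN : p + q ≤ N + 1)
    (hf : ∀ i j, ¬(i < p ∧ j < q) → f i j = 0) :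
    ∑ s ∈ Finset.range N, ∑ i ∈ Finset.range (s + 1), f i (s - i)
      = ∑ i ∈ Finset.range p, ∑ j ∈ Finset.range q, f i j := by
  rw [Finset.sum_range_diag_flip, Finset.sum_sigma', Finset.sum_sigma']
  refine Finset.sum_congr_of_eq_on_inter ?_ ?_ ?_
  · rintro ⟨i, j⟩ - h
    refine hf i j fun h' => h ?_
    simpa using h'
  · rintro ⟨i, j⟩ h h'
    simp at h h'
    omega
  · intros; rfl

/-- The value preceding index `t` in a sequence, and `0` for `t = 0`. -/
def shiftSeq {α : Type*} [Zero α] (f : ℕ → α) : ℕ → α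
  | 0 => 0
  | t + 1 => f t

theorem sum_norm_sq_le_shift_diff (m : ℕ) (a : ℕ → ℕ → F)
    (ha : ∀ i j, m + 1 ≤ j → a i j = 0) (h0 : a 0 m = 0) :
    ∑ i ∈ Finset.range (m + 1), ∑ j ∈ Finset.range (m + 1), ‖a i j‖ ^ 2
      ≤ ((m : ℝ) + 1) ^ 2 / 2 * ∑ i ∈ Finset.range m, ∑ t ∈ Finset.range (m + 2),
          ‖a i t - shiftSeq (a (i + 1)) t‖ ^ 2 := by
  set A : ℕ → ℕ → ℝ := fun i j => if i < m + 1 ∧ j < m + 1 then ‖a i j‖ ^ 2 else 0 with hA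
  set G : ℕ → ℕ → ℝ := fun i t =>
    if i < m ∧ t < m + 2 then ‖a i t - shiftSeq (a (i + 1)) t‖ ^ 2 else 0 with hG
  have hG0 : ∀ i t, 0 ≤ G i t := fun i t => by simp only [hG]; split_ifs <;> positivity
  have hAle : ∀ i j, A i j ≤ ‖a i j‖ ^ 2 := fun i j => by
    simp only [hA]; split_ifs
    · exact le_rfl
    · positivity
  have eA : ∑ i ∈ Finset.range (m + 1), ∑ j ∈ Finset.range (m + 1), ‖a i j‖ ^ 2
      = ∑ i ∈ Finset.range (m + 1), ∑ j ∈ Finset.range (m + 1), A i j := by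
    refine Finset.sum_congr rfl fun i hi => Finset.sum_congr rfl fun j hj => ?_
    rw [Finset.mem_range] at hi hj
    exact (if_pos ⟨hi, hj⟩).symm
  have eG : ∑ i ∈ Finset.range m, ∑ t ∈ Finset.range (m + 2),
        ‖a i t - shiftSeq (a (i + 1)) t‖ ^ 2
      = ∑ i ∈ Finset.range m, ∑ t ∈ Finset.range (m + 2), G i t := by
    refine Finset.sum_congr rfl fun i hi => Finset.sum_congr rfl fun j hj => ?_
    rw [Finset.mem_range] at hi hj
    exact (if_pos ⟨hi, hj⟩).symm
  rw [eA, eG, ← sum_range_antidiag_eq A (N := 2 * m + 1) (by omega) (fun i j h => if_neg h),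
    ← sum_range_antidiag_eq G (N := 2 * m + 1) (by omega) (fun i j h => if_neg h),
    Finset.mul_sum]
  refine Finset.sum_le_sum fun s _ => ?_
  rcases le_or_gt m s with hs | hs
  · have hx0 : a 0 (s - 0) = 0 := by
      rcases hs.eq_or_lt with rfl | h
      · exact h0
      · exact ha _ _ (by omega)
    have hx := sum_norm_sq_le_of_zero (fun i => a i (s - i)) hx0 m
    calc ∑ i ∈ Finset.range (s + 1), A i (s - i)
        = ∑ i ∈ Finset.range (m + 1), A i (s - i) := by
          symm
          refine Finset.sum_subset (Finset.range_subset_range.2 (by omega)) fun i _ hi => ?_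
          simp only [Finset.mem_range] at hi
          exact if_neg fun h => hi h.1
      _ ≤ ∑ i ∈ Finset.range (m + 1), ‖a i (s - i)‖ ^ 2 :=
          Finset.sum_le_sum fun i _ => hAle _ _
      _ ≤ _ := hx
      _ = ((m : ℝ) + 1) ^ 2 / 2 * ∑ l ∈ Finset.range m, G l (s - l) := by
          congr 1
          refine Finset.sum_congr rfl fun l hl => ?_
          rw [Finset.mem_range] at hl
          obtain ⟨t, ht⟩ : ∃ t, s - l = t + 1 := ⟨s - l - 1, by omega⟩
          have ht' : s - (l + 1) = t := by omega
          simp only [hG, ht, ht', shiftSeq, hl, true_and]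
          split_ifs with h
          · rw [norm_sub_rev]
          · rw [ha _ _ (by omega), ha _ _ (by omega)]
            simp
      _ ≤ _ := by
          gcongr ?_ * ?_
          exact Finset.sum_le_sum_of_subset_of_nonneg
            (Finset.range_subset_range.2 (by omega)) fun _ _ _ => hG0 _ _
  · have hx := sum_norm_sq_le_of_zero
      (fun u => if u = 0 then (0 : F) else a (s + 1 - u) (u - 1)) (by simp) (s + 1)
    rw [Finset.sum_range_succ'] at hx
    simp only [Nat.add_eq_zero_iff, one_ne_zero, and_false, if_false, Nat.add_sub_add_right,
      Nat.add_sub_cancel, if_true, norm_zero, ne_eq, OfNat.ofNat_ne_zero, not_false_eq_true,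
      zero_pow, add_zero] at hx
    rw [← Finset.sum_range_reflect, ← Finset.sum_range_reflect (fun i => G i (s - i))]
    have e : ∀ u ∈ Finset.range (s + 1), s - (s + 1 - 1 - u) = u ∧ s + 1 - 1 - u = s - u := by
      intro u hu
      rw [Finset.mem_range] at hu
      omega
    calc ∑ u ∈ Finset.range (s + 1), A (s + 1 - 1 - u) (s - (s + 1 - 1 - u))
        ≤ ∑ u ∈ Finset.range (s + 1), ‖a (s - u) u‖ ^ 2 :=
          Finset.sum_le_sum fun u hu => by
            rw [(e u hu).1, (e u hu).2]; exact hAle _ _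
      _ ≤ _ := hx
      _ = (((s + 1 : ℕ) : ℝ) + 1) ^ 2 / 2 *
            ∑ u ∈ Finset.range (s + 1), G (s + 1 - 1 - u) (s - (s + 1 - 1 - u)) := by
          congr 1
          refine Finset.sum_congr rfl fun u hu => ?_
          rw [(e u hu).1, (e u hu).2]
          rw [Finset.mem_range] at hu
          simp only [hG]
          rw [if_pos (show s - u < m ∧ u < m + 2 by omega)]
          rcases u with _ | u
          · simp [shiftSeq]
          · have : s - (u + 1) + 1 = s + 1 - (u + 1) := by omega
            simp [shiftSeq, this]
      _ ≤ _ := by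
          have : ((s + 1 : ℕ) : ℝ) ≤ m := by exact_mod_cast hs
          have := Finset.sum_nonneg fun u (_ : u ∈ Finset.range (s + 1)) =>
            hG0 (s + 1 - 1 - u) (s - (s + 1 - 1 - u))
          gcongr

/-! ### pencils acting on coefficient sequences -/

/-- The coefficients of `(λ X + Y) w(λ)`, where `w t` is the coefficient of `λ^t` in `w(λ)`. -/
def pencilAct {ρ γ : Type*} [Fintype γ] (X Y : Matrix ρ γ F) (w : ℕ → γ → F) (t : ℕ) : ρ → F :=
  Y *ᵥ w t + X *ᵥ shiftSeq w t

theorem coeff_pencil_mulVec {ρ γ : Type*} [Fintype γ] (X Y : Matrix ρ γ F) (w : γ → F[X])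
    (t : ℕ) (p : ρ) :
    ((pencil X Y *ᵥ w) p).coeff t = pencilAct X Y (fun j q => (w q).coeff j) t p := by
  cases t <;>
    simp [pencil, pencilAct, shiftSeq, Matrix.mulVec, dotProduct, add_mul, mul_assoc,
      Polynomial.finsetSum_coeff, Finset.sum_add_distrib, add_comm]

theorem pencilAct_add {ρ γ : Type*} [Fintype γ] (X Y : Matrix ρ γ F) (w v : ℕ → γ → F) :
    pencilAct X Y (w + v) = pencilAct X Y w + pencilAct X Y v := by
  funext t
  cases t <;> simp [pencilAct, shiftSeq, Matrix.mulVec_add, add_add_add_comm]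

theorem pencilAct_smul {ρ γ : Type*} [Fintype γ] (X Y : Matrix ρ γ F) (a : F)
    (w : ℕ → γ → F) : pencilAct X Y (a • w) = a • pencilAct X Y w := by
  funext t
  cases t <;> simp [pencilAct, shiftSeq, Matrix.mulVec_smul]

theorem add_pencilAct {ρ γ : Type*} [Fintype γ] (X Y X' Y' : Matrix ρ γ F) (w : ℕ → γ → F) :
    pencilAct (X + X') (Y + Y') w = pencilAct X Y w + pencilAct X' Y' w := by
  funext t
  simp [pencilAct, Matrix.add_mulVec, add_add_add_comm]

theorem sum_vecNormSq_shiftSeq {γ : Type*} [Fintype γ] (w : ℕ → γ → F) (k : ℕ) :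
    ∑ t ∈ Finset.range (k + 1), vecNormSq (shiftSeq w t)
      = ∑ t ∈ Finset.range k, vecNormSq (w t) := by
  rw [Finset.sum_range_succ']
  simp [shiftSeq, vecNormSq]

theorem sum_vecNormSq_pencilAct_le {ρ γ : Type*} [Fintype ρ] [Fintype γ] (X Y : Matrix ρ γ F)
    {w : ℕ → γ → F} {k : ℕ} (hw : w k = 0) :
    ∑ t ∈ Finset.range (k + 1), vecNormSq (pencilAct X Y w t)
      ≤ 2 * penFrob X Y ^ 2 * ∑ t ∈ Finset.range k, vecNormSq (w t) := by
  calc ∑ t ∈ Finset.range (k + 1), vecNormSq (pencilAct X Y w t)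
      ≤ ∑ t ∈ Finset.range (k + 1),
          (frobSq X + frobSq Y) * (vecNormSq (w t) + vecNormSq (shiftSeq w t)) :=
        Finset.sum_le_sum fun t _ => vecNormSq_mulVec_add_mulVec_le X Y _ _
    _ = _ := by
        rw [← Finset.mul_sum, Finset.sum_add_distrib, sum_vecNormSq_shiftSeq,
          Finset.sum_range_succ, hw, vecNormSq_eq_zero.2 rfl, penFrob_sq]
        ring

/-! ### the coefficients of the pencil `λ [0 ∣ -R̃] + [R̃ ∣ 0]` -/

/-- The inclusion of the block indices `0, …, k - 2` into `0, …, k - 1`. -/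
def loIdx {k n : ℕ} (p : Fin (k - 1) × Fin n) : Fin k × Fin n :=
  (⟨(p.1 : ℕ), by have := p.1.isLt; omega⟩, p.2)

/-- The shift of the block indices `0, …, k - 2` to `1, …, k - 1`. -/
def hiIdx {k n : ℕ} (p : Fin (k - 1) × Fin n) : Fin k × Fin n :=
  (⟨(p.1 : ℕ) + 1, by have := p.1.isLt; omega⟩, p.2)

theorem loIdx_injective {k n : ℕ} : Function.Injective (loIdx (k := k) (n := n)) := by
  rintro ⟨i, c⟩ ⟨i', c'⟩ h
  simpa [loIdx, Fin.ext_iff] using h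

theorem hiIdx_injective {k n : ℕ} : Function.Injective (hiIdx (k := k) (n := n)) := by
  rintro ⟨i, c⟩ ⟨i', c'⟩ h
  simpa [hiIdx, Fin.ext_iff] using h

/-- `[0 ∣ -R̃]`. -/
def BpencilX {k n : ℕ} (R : Matrix (Fin (k - 1) × Fin n) (Fin (k - 1) × Fin n) F) :
    Matrix (Fin (k - 1) × Fin n) (Fin k × Fin n) F :=
  Matrix.of fun p q =>
    if h : 0 < (q.1 : ℕ) then
      -R p (⟨(q.1 : ℕ) - 1, by have := q.1.isLt; omega⟩, q.2)
    else 0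

/-- `[R̃ ∣ 0]`. -/
def BpencilY {k n : ℕ} (R : Matrix (Fin (k - 1) × Fin n) (Fin (k - 1) × Fin n) F) :
    Matrix (Fin (k - 1) × Fin n) (Fin k × Fin n) F :=
  Matrix.of fun p q => if h : (q.1 : ℕ) < k - 1 then R p (⟨(q.1 : ℕ), h⟩, q.2) else 0

section

variable {k n : ℕ} (R : Matrix (Fin (k - 1) × Fin n) (Fin (k - 1) × Fin n) F)

theorem Bpencil_add_pencil (X Y : Matrix (Fin (k - 1) × Fin n) (Fin k × Fin n) F) :
    Bpencil R + pencil X Y = pencil (BpencilX R + X) (BpencilY R + Y) := by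
  ext1 p q
  simp only [Bpencil, pencil, BpencilX, BpencilY, Matrix.of_apply, Matrix.add_apply,
    Polynomial.C_add]
  split_ifs <;> simp only [Polynomial.C_neg, Polynomial.C_0] <;> ring

theorem BpencilX_submatrix : (BpencilX R).submatrix id hiIdx = -R := by
  ext p q
  simp [BpencilX, hiIdx]

theorem BpencilY_submatrix : (BpencilY R).submatrix id loIdx = R := by
  ext p q
  simp [BpencilY, loIdx]

theorem BpencilX_mulVec (x : Fin k × Fin n → F) :
    BpencilX R *ᵥ x = -(R *ᵥ (x ∘ hiIdx)) := by
  rw [← Matrix.neg_mulVec, ← BpencilX_submatrix]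
  funext p
  refine (Fintype.sum_of_injective hiIdx hiIdx_injective _ _ ?_ fun _ => rfl).symm
  rintro ⟨i, c⟩ h
  have hi : ¬ 0 < (i : ℕ) := fun hi => h
    ⟨(⟨(i : ℕ) - 1, by omega⟩, c), by simp [hiIdx, Fin.ext_iff]; omega⟩
  simp [BpencilX, hi]

theorem BpencilY_mulVec (x : Fin k × Fin n → F) :
    BpencilY R *ᵥ x = R *ᵥ (x ∘ loIdx) := by
  conv_rhs => rw [← BpencilY_submatrix R]
  funext p
  refine (Fintype.sum_of_injective loIdx loIdx_injective _ _ ?_ fun _ => rfl).symm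
  rintro ⟨i, c⟩ h
  have hi : ¬ (i : ℕ) < k - 1 := fun hi => h ⟨(⟨(i : ℕ), hi⟩, c), rfl⟩
  simp [BpencilY, hi]

theorem pencilAct_Bpencil (w : ℕ → Fin k × Fin n → F) (t : ℕ) :
    pencilAct (BpencilX R) (BpencilY R) w t
      = R *ᵥ fun p => w t (loIdx p) - shiftSeq w t (hiIdx p) := by
  rw [pencilAct, BpencilX_mulVec, BpencilY_mulVec, ← sub_eq_add_neg, ← Matrix.mulVec_sub]
  rfl

theorem sum_vecNormSq_le_shift_diff (hk : 0 < k) {w : ℕ → Fin k × Fin n → F}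
    (hw : ∀ j, k ≤ j → w j = 0) (h0 : ∀ c, w (k - 1) (⟨0, hk⟩, c) = 0) :
    ∑ j ∈ Finset.range k, vecNormSq (w j)
      ≤ (k : ℝ) ^ 2 / 2 * ∑ t ∈ Finset.range (k + 1),
          vecNormSq (fun p : Fin (k - 1) × Fin n => w t (loIdx p) - shiftSeq w t (hiIdx p)) := by
  obtain ⟨m, rfl⟩ : ∃ m, k = m + 1 := ⟨k - 1, by omega⟩
  set a : Fin n → ℕ → ℕ → F := fun c i j =>
    if h : i < m + 1 then w j (⟨i, h⟩, c) else 0 with ha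
  have key := Finset.sum_le_sum fun c (_ : c ∈ (Finset.univ : Finset (Fin n))) =>
    sum_norm_sq_le_shift_diff m (a c)
      (fun i j hj => by simp only [ha]; split_ifs <;> simp [hw j hj])
      (by simpa [ha] using h0 c)
  have e1 : ∑ j ∈ Finset.range (m + 1), vecNormSq (w j)
      = ∑ c, ∑ i ∈ Finset.range (m + 1), ∑ j ∈ Finset.range (m + 1), ‖a c i j‖ ^ 2 := by
    simp only [vecNormSq, Fintype.sum_prod_type_right]
    rw [Finset.sum_comm]
    refine Finset.sum_congr rfl fun c _ => ?_
    rw [Finset.sum_comm, Finset.sum_range]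
    refine Finset.sum_congr rfl fun i _ => Finset.sum_congr rfl fun j _ => ?_
    simp only [ha]
    rw [dif_pos i.isLt]
  have e2 : ∑ t ∈ Finset.range (m + 1 + 1), vecNormSq
        (fun p : Fin (m + 1 - 1) × Fin n => w t (loIdx p) - shiftSeq w t (hiIdx p))
      = ∑ c, ∑ i ∈ Finset.range m, ∑ t ∈ Finset.range (m + 2),
          ‖a c i t - shiftSeq (a c (i + 1)) t‖ ^ 2 := by
    simp only [vecNormSq, Fintype.sum_prod_type_right]
    rw [Finset.sum_comm]
    refine Finset.sum_congr rfl fun c _ => ?_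
    rw [Finset.sum_comm, Finset.sum_range]
    refine Finset.sum_congr rfl fun i _ => Finset.sum_congr rfl fun t _ => ?_
    have hi : (i : ℕ) < m := i.isLt
    cases t <;> simp [ha, loIdx, hiIdx, shiftSeq, hi, hi.le]
  rw [e1, e2, Finset.mul_sum]
  exact_mod_cast key

/-- The pencil `λ [0 ∣ -R̃] + [R̃ ∣ 0]` is bounded below on vector polynomials of grade `k - 1`
whose first block has no term of degree `k - 1`. -/
theorem sigmaMin_sq_mul_sum_le (hk : 0 < k) {w : ℕ → Fin k × Fin n → F}
    (hw : ∀ j, k ≤ j → w j = 0) (h0 : ∀ c, w (k - 1) (⟨0, hk⟩, c) = 0) :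
    sigmaMin R ^ 2 * ∑ j ∈ Finset.range k, vecNormSq (w j)
      ≤ (k : ℝ) ^ 2 / 2 * ∑ t ∈ Finset.range (k + 1),
          vecNormSq (pencilAct (BpencilX R) (BpencilY R) w t) := by
  calc sigmaMin R ^ 2 * ∑ j ∈ Finset.range k, vecNormSq (w j)
      ≤ sigmaMin R ^ 2 * _ :=
        mul_le_mul_of_nonneg_left (sum_vecNormSq_le_shift_diff hk hw h0) (sq_nonneg _)
    _ = (k : ℝ) ^ 2 / 2 * ∑ t ∈ Finset.range (k + 1), sigmaMin R ^ 2 *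
          vecNormSq (fun p : Fin (k - 1) × Fin n => w t (loIdx p) - shiftSeq w t (hiIdx p)) := by
        rw [← Finset.mul_sum]
        ring
    _ ≤ _ := by
        gcongr with t
        rw [pencilAct_Bpencil]
        exact sigmaMin_sq_mul_le R _

variable {R} {ΔX ΔY : Matrix (Fin (k - 1) × Fin n) (Fin k × Fin n) F}

theorem eq_zero_of_pencilAct_eq_zero (hk : 0 < k)
    (hΔ : (k : ℝ) * penFrob ΔX ΔY < sigmaMin R) {w : ℕ → Fin k × Fin n → F}
    (hw : ∀ j, k ≤ j → w j = 0) (h0 : ∀ c, w (k - 1) (⟨0, hk⟩, c) = 0)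
    (hact : ∀ t, t < k + 1 → pencilAct (BpencilX R + ΔX) (BpencilY R + ΔY) w t = 0) :
    w = 0 := by
  have h1 := sigmaMin_sq_mul_sum_le R hk hw h0
  have h2 := sum_vecNormSq_pencilAct_le ΔX ΔY (hw k le_rfl)
  have h3 : ∑ t ∈ Finset.range (k + 1), vecNormSq (pencilAct (BpencilX R) (BpencilY R) w t)
      = ∑ t ∈ Finset.range (k + 1), vecNormSq (pencilAct ΔX ΔY w t) := by
    refine Finset.sum_congr rfl fun t ht => ?_
    have h := hact t (Finset.mem_range.1 ht)
    rw [add_pencilAct, Pi.add_apply, add_eq_zero_iff_eq_neg] at h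
    rw [h, vecNormSq_neg]
  rw [h3] at h1
  set E := ∑ j ∈ Finset.range k, vecNormSq (w j) with hE
  have hE0 : 0 ≤ E := Finset.sum_nonneg fun _ _ => vecNormSq_nonneg _
  have hβ : 0 ≤ penFrob ΔX ΔY := Real.sqrt_nonneg _
  have h4 : sigmaMin R ^ 2 * E ≤ ((k : ℝ) * penFrob ΔX ΔY) ^ 2 * E := by
    refine h1.trans ((mul_le_mul_of_nonneg_left h2 (by positivity)).trans_eq (by ring))
  have h5 : ((k : ℝ) * penFrob ΔX ΔY) ^ 2 < sigmaMin R ^ 2 :=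
    pow_lt_pow_left₀ hΔ (by positivity) two_ne_zero
  have h6 : E = 0 := by nlinarith
  rw [hE, Finset.sum_eq_zero_iff_of_nonneg fun _ _ => vecNormSq_nonneg _] at h6
  funext j
  rcases lt_or_ge j k with hj | hj
  · exact vecNormSq_eq_zero.1 (h6 j (Finset.mem_range.2 hj))
  · exact hw j hj

/-- The null vectors of the perturbed pencil of grade `k - 1` can be prescribed by the term of
degree `k - 1` in their first block. -/
theorem exists_pencilAct_eq_zero (hk : 0 < k)
    (hΔ : (k : ℝ) * penFrob ΔX ΔY < sigmaMin R) (e : Fin n → F) :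
    ∃ d : ℕ → Fin k × Fin n → F, (∀ j, k ≤ j → d j = 0) ∧
      (∀ c, d (k - 1) (⟨0, hk⟩, c) = e c) ∧
      ∀ t, pencilAct (BpencilX R + ΔX) (BpencilY R + ΔY) d t = 0 := by
  let ext : (Fin k → Fin k × Fin n → F) →ₗ[F] (ℕ → Fin k × Fin n → F) :=
    { toFun := fun d j => if h : j < k then d ⟨j, h⟩ else 0
      map_add' := fun d d' => by funext j; by_cases h : j < k <;> simp [h]
      map_smul' := fun a d => by funext j; by_cases h : j < k <;> simp [h] }
  have hext : ∀ d j, k ≤ j → ext d j = 0 := fun d j hj => dif_neg (by omega)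
  let L : (Fin k → Fin k × Fin n → F) →ₗ[F]
      (Fin (k + 1) → Fin (k - 1) × Fin n → F) × (Fin n → F) :=
    { toFun := fun d =>
        (fun t => pencilAct (BpencilX R + ΔX) (BpencilY R + ΔY) (ext d) t,
          fun c => ext d (k - 1) (⟨0, hk⟩, c))
      map_add' := fun d d' => by
        simp only [map_add, pencilAct_add]
        rfl
      map_smul' := fun a d => by
        simp only [map_smul, pencilAct_smul]
        rfl }
  have hinj : Function.Injective L := by
    rw [injective_iff_map_eq_zero]
    intro d hd
    have hz : ext d = 0 := by
      refine eq_zero_of_pencilAct_eq_zero hk hΔ (hext d) ?_ ?_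
      · intro c
        exact congrFun (congrArg Prod.snd hd) c
      · intro t ht
        exact congrFun (congrArg Prod.fst hd) ⟨t, ht⟩
    funext j
    have := congrFun hz j
    simpa [ext] using this
  have hdim : Module.finrank F (Fin k → Fin k × Fin n → F)
      = Module.finrank F ((Fin (k + 1) → Fin (k - 1) × Fin n → F) × (Fin n → F)) := by
    obtain ⟨m, rfl⟩ : ∃ m, k = m + 1 := ⟨k - 1, by omega⟩
    simp [Module.finrank_pi_fintype]
    ring
  obtain ⟨d, hd⟩ :=
    (LinearMap.injective_iff_surjective_of_finrank_eq_finrank hdim).1 hinj (0, e)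
  refine ⟨ext d, hext d, fun c => congrFun (congrArg Prod.snd hd) c, fun t => ?_⟩
  rcases lt_or_ge t (k + 1) with ht | ht
  · exact congrFun (congrArg Prod.fst hd) ⟨t, ht⟩
  · obtain ⟨t, rfl⟩ : ∃ s, t = s + 1 := ⟨t - 1, by omega⟩
    simp [pencilAct, shiftSeq, hext d t (by omega), hext d (t + 1) (by omega)]

end

/-! ### minimality criteria -/

theorem mulVec_eq_zero_of_mem_rowSpan {ρ ρ' γ : Type*} [Fintype γ] {P : Matrix ρ γ F[X]}
    {Q : Matrix ρ' γ F[X]} (h : P * Qᵀ = 0) {v : γ → F[X]} (hv : polyVec v ∈ rowSpan P) :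
    Q *ᵥ v = 0 := by
  have hmap : ∀ x : γ → F[X], matRF Q *ᵥ polyVec x = polyVec (Q *ᵥ x) := fun x => by
    funext i
    exact (RingHom.map_mulVec (algebraMap F[X] (RatFunc F)) Q x i).symm
  have hle : rowSpan P ≤ LinearMap.ker (Matrix.mulVecLin (matRF Q)) := by
    refine Submodule.span_le.2 ?_
    rintro _ ⟨i, rfl⟩
    have hi : Q *ᵥ P i = 0 := by
      funext j
      have := congrFun (congrFun h i) j
      rw [Matrix.mul_apply] at this
      simpa [Matrix.mulVec, dotProduct, mul_comm] using this
    rw [SetLike.mem_coe, LinearMap.mem_ker, Matrix.mulVecLin_apply, hmap, hi]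
    funext j
    simp [polyVec]
  have hv' := hle hv
  rw [LinearMap.mem_ker, Matrix.mulVecLin_apply, hmap] at hv'
  funext j
  exact (map_eq_zero_iff _ (RatFunc.algebraMap_injective F)).1 (congrFun hv' j)

theorem linearIndependent_polyVec_of_det_ne_zero {ρ γ : Type*} [Fintype ρ] [DecidableEq ρ]
    {P : Matrix ρ γ F[X]} (f : ρ → γ)
    (h : ((P.submatrix id f).map (Polynomial.eval 0)).det ≠ 0) :
    LinearIndependent (RatFunc F) fun i => polyVec (P i) := by
  have h1 : (P.submatrix id f).det ≠ 0 := by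
    intro h0
    refine h ?_
    have := RingHom.map_det (Polynomial.evalRingHom (0 : F)) (P.submatrix id f)
    rw [h0, map_zero] at this
    exact this.symm
  have h2 : ((matRF P).submatrix id f).det ≠ 0 := by
    have := RingHom.map_det (algebraMap F[X] (RatFunc F)) (P.submatrix id f)
    intro h0
    refine h1 ((map_eq_zero_iff _ (RatFunc.algebraMap_injective F)).1 (this.trans h0))
  exact (Matrix.linearIndependent_rows_of_det_ne_zero h2).of_comp
    (LinearMap.funLeft (RatFunc F) (RatFunc F) f)

theorem isMinimalBasisMat_of_le_polyVecDeg {ρ γ : Type*} [Fintype ρ] [Fintype γ]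
    {P : Matrix ρ γ F[X]} {m : ℕ} (hP : LinearIndependent (RatFunc F) fun i => polyVec (P i))
    (hdeg : ∀ i, polyVecDeg (P i) = m)
    (hmin : ∀ v : γ → F[X], polyVec v ∈ rowSpan P → v ≠ 0 → m ≤ polyVecDeg v) :
    IsMinimalBasisMat P := by
  refine ⟨⟨hP, rfl⟩, fun d b hb => ?_⟩
  have hd : Fintype.card ρ = d := by
    have h1 : Module.finrank (RatFunc F) (rowSpan P) = Fintype.card ρ :=
      finrank_span_eq_card hP
    have h2 := finrank_span_eq_card hb.1
    rw [hb.2, h1, Fintype.card_fin] at h2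
    exact h2
  have hb' : ∀ i, m ≤ polyVecDeg (b i) := fun i => by
    refine hmin _ (hb.2 ▸ Submodule.subset_span ⟨i, rfl⟩) fun h0 => hb.1.ne_zero i ?_
    funext j
    simp [h0, polyVec]
  calc ∑ i, polyVecDeg (P i) = ∑ _i : Fin d, m := by simp [hdeg, hd]
    _ ≤ _ := Finset.sum_le_sum fun i _ => hb' i

theorem polyVecDeg_eq_of_coeff_ne_zero {γ : Type*} [Fintype γ] {v : γ → F[X]} {m : ℕ}
    (hle : ∀ q, (v q).natDegree ≤ m) {q : γ} (hq : (v q).coeff m ≠ 0) : polyVecDeg v = m :=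
  le_antisymm (Finset.sup_le fun q _ => hle q)
    ((Polynomial.le_natDegree_of_ne_zero hq).trans
      (Finset.le_sup (f := fun i => (v i).natDegree) (Finset.mem_univ q)))

theorem natDegree_le_polyVecDeg {γ : Type*} [Fintype γ] (v : γ → F[X]) (q : γ) :
    (v q).natDegree ≤ polyVecDeg v :=
  Finset.le_sup (f := fun i => (v i).natDegree) (Finset.mem_univ q)

/-! ### the coefficients of `Λ_k(λ) ⊗ I_n` -/

/-- The coefficient of `λ^j` in column `c` of `Λ_k(λ) ⊗ I_n`. -/
def lamSeq (F : Type*) [RCLike F] (k : ℕ) {n : ℕ} (c : Fin n) (j : ℕ) : Fin k × Fin n → F :=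
  fun q => if q.2 = c ∧ j = k - 1 - (q.1 : ℕ) then 1 else 0

section

variable {k n : ℕ}

theorem coeff_Lam (q : Fin k × Fin n) (c : Fin n) (j : ℕ) :
    (Lam F k n q c).coeff j = lamSeq F k c j q := by
  by_cases h : q.2 = c <;> simp [Lam, lamSeq, h, Polynomial.coeff_X_pow]

theorem lamSeq_eq_zero (c : Fin n) {j : ℕ} (hj : k ≤ j) : lamSeq F k c j = 0 := by
  funext q
  exact if_neg fun h => by omega

theorem mulVec_lamSeq {ρ : Type*} (A : Matrix ρ (Fin k × Fin n) F) (c : Fin n) (j : Fin k) :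
    A *ᵥ lamSeq F k c j = fun p => A p (j.rev, c) := by
  have h : lamSeq F k c j = Pi.single (j.rev, c) 1 := by
    funext q
    have hq : (q.2 = c ∧ (j : ℕ) = k - 1 - (q.1 : ℕ)) ↔ q = (j.rev, c) := by
      have hrev : q.1 = j.rev ↔ (q.1 : ℕ) = k - ((j : ℕ) + 1) := by rw [Fin.ext_iff, Fin.val_rev]
      simp only [Prod.ext_iff, hrev]
      have := q.1.isLt
      have := j.isLt
      constructor
      · rintro ⟨h1, h2⟩
        exact ⟨by omega, h1⟩
      · rintro ⟨h1, h2⟩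
        exact ⟨h2, by omega⟩
    simp only [lamSeq, hq, Pi.single_apply]
  rw [h, Matrix.mulVec_single_one]
  rfl

theorem sum_vecNormSq_mulVec_lamSeq {ρ : Type*} [Fintype ρ] (A : Matrix ρ (Fin k × Fin n) F) :
    ∑ c, ∑ t ∈ Finset.range k, vecNormSq (A *ᵥ lamSeq F k c t) = frobSq A := by
  simp only [Finset.sum_range, mulVec_lamSeq, vecNormSq, frobSq, Fintype.sum_prod_type_right]
  rw [Finset.sum_comm' (t' := Finset.univ) (s' := fun _ => Finset.univ) (by simp)]
  rw [Finset.sum_comm]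
  conv_rhs => rw [Finset.sum_comm]
  refine Finset.sum_congr rfl fun c _ => ?_
  conv_rhs => rw [Finset.sum_comm]
  exact Equiv.sum_comp Fin.revPerm fun i => ∑ p, ‖A p (i, c)‖ ^ 2

theorem vecNormSq_add_le {ι : Type*} [Fintype ι] (x y : ι → F) :
    vecNormSq (x + y) ≤ 2 * (vecNormSq x + vecNormSq y) := by
  simp only [vecNormSq, ← Finset.sum_add_distrib, Finset.mul_sum]
  refine Finset.sum_le_sum fun i _ => ?_
  have h : ‖(x + y) i‖ ≤ ‖x i‖ + ‖y i‖ := norm_add_le _ _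
  nlinarith [norm_nonneg ((x + y) i), sq_nonneg (‖x i‖ - ‖y i‖)]

theorem sum_vecNormSq_pencilAct_lamSeq_le {ρ : Type*} [Fintype ρ]
    (X Y : Matrix ρ (Fin k × Fin n) F) :
    ∑ c, ∑ t ∈ Finset.range (k + 1), vecNormSq (pencilAct X Y (lamSeq F k c) t)
      ≤ 2 * penFrob X Y ^ 2 := by
  have hX : ∀ c : Fin n, ∑ t ∈ Finset.range (k + 1), vecNormSq (X *ᵥ shiftSeq (lamSeq F k c) t)
      = ∑ t ∈ Finset.range k, vecNormSq (X *ᵥ lamSeq F k c t) := fun c => by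
    rw [Finset.sum_range_succ']
    simp [shiftSeq, vecNormSq]
  have hY : ∀ c : Fin n, ∑ t ∈ Finset.range (k + 1), vecNormSq (Y *ᵥ lamSeq F k c t)
      = ∑ t ∈ Finset.range k, vecNormSq (Y *ᵥ lamSeq F k c t) := fun c => by
    rw [Finset.sum_range_succ, lamSeq_eq_zero c le_rfl]
    simp [vecNormSq]
  calc ∑ c, ∑ t ∈ Finset.range (k + 1), vecNormSq (pencilAct X Y (lamSeq F k c) t)
      ≤ ∑ c, ∑ t ∈ Finset.range (k + 1), 2 * (vecNormSq (Y *ᵥ lamSeq F k c t)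
          + vecNormSq (X *ᵥ shiftSeq (lamSeq F k c) t)) :=
        Finset.sum_le_sum fun c _ => Finset.sum_le_sum fun t _ => vecNormSq_add_le _ _
    _ = _ := by
        simp only [← Finset.mul_sum, Finset.sum_add_distrib, hX, hY,
          sum_vecNormSq_mulVec_lamSeq, penFrob_sq]
        ring

variable (R : Matrix (Fin (k - 1) × Fin n) (Fin (k - 1) × Fin n) F)

theorem pencilAct_Bpencil_lamSeq (c : Fin n) (t : ℕ) :
    pencilAct (BpencilX R) (BpencilY R) (lamSeq F k c) t = 0 := by
  rw [pencilAct_Bpencil]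
  convert Matrix.mulVec_zero R
  rename_i p
  have hp := p.1.isLt
  rw [Pi.zero_apply, sub_eq_zero]
  rcases t with _ | t
  · exact if_neg fun h => by simp [loIdx] at h; omega
  · simp only [shiftSeq, lamSeq, loIdx, hiIdx]
    congr 1
    rw [eq_iff_iff]
    refine and_congr_right fun _ => ?_
    omega

variable {R} {ΔX ΔY : Matrix (Fin (k - 1) × Fin n) (Fin k × Fin n) F}

theorem sigmaMin_mul_sqrt_le (hk : 0 < k) {w : Fin n → ℕ → Fin k × Fin n → F}
    (hw : ∀ c j, k ≤ j → w c j = 0) (h0 : ∀ c c', w c (k - 1) (⟨0, hk⟩, c') = 0)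
    (hact : ∀ c t,
      pencilAct (BpencilX R + ΔX) (BpencilY R + ΔY) (w c + lamSeq F k c) t = 0) :
    sigmaMin R * √(∑ c, ∑ j ∈ Finset.range k, vecNormSq (w c j))
      ≤ k * penFrob ΔX ΔY * (√(∑ c, ∑ j ∈ Finset.range k, vecNormSq (w c j)) + 1) := by
  set E := ∑ c, ∑ j ∈ Finset.range k, vecNormSq (w c j) with hE
  have hE0 : 0 ≤ E :=
    Finset.sum_nonneg fun _ _ => Finset.sum_nonneg fun _ _ => vecNormSq_nonneg _
  have hβ : 0 ≤ penFrob ΔX ΔY := Real.sqrt_nonneg _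
  set β := penFrob ΔX ΔY
  set S := ∑ c, ∑ t ∈ Finset.range (k + 1),
    vecNormSq (pencilAct ΔX ΔY (w c) t + pencilAct ΔX ΔY (lamSeq F k c) t) with hS
  have h1 : sigmaMin R ^ 2 * E ≤ (k : ℝ) ^ 2 / 2 * S := by
    rw [hE, hS, Finset.mul_sum, Finset.mul_sum]
    refine Finset.sum_le_sum fun c _ => ?_
    refine (sigmaMin_sq_mul_sum_le R hk (hw c) (h0 c)).trans_eq ?_
    congr 1
    refine Finset.sum_congr rfl fun t _ => ?_
    have h := hact c t
    rw [add_pencilAct, pencilAct_add, pencilAct_add, Pi.add_apply, Pi.add_apply, Pi.add_apply,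
      pencilAct_Bpencil_lamSeq, add_zero, add_eq_zero_iff_eq_neg] at h
    rw [h, vecNormSq_neg]
  have h2 : √S ≤ √2 * β * (√E + 1) := by
    have hsum : ∀ f : Fin n → ℕ → Fin (k - 1) × Fin n → F,
        ∑ c, ∑ t ∈ Finset.range (k + 1), vecNormSq (f c t)
          = ∑ i : Fin n × Fin (k + 1) × (Fin (k - 1) × Fin n), ‖f i.1 i.2.1 i.2.2‖ ^ 2 :=
      fun f => by
        simp only [Fintype.sum_prod_type (α₁ := Fin n),
          Fintype.sum_prod_type (α₁ := Fin (k + 1)), Finset.sum_range, vecNormSq]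
    have hw2 : ∑ c, ∑ t ∈ Finset.range (k + 1), vecNormSq (pencilAct ΔX ΔY (w c) t)
        ≤ 2 * β ^ 2 * E := by
      rw [hE, Finset.mul_sum]
      exact Finset.sum_le_sum fun c _ => sum_vecNormSq_pencilAct_le ΔX ΔY (hw c k le_rfl)
    have hl2 := sum_vecNormSq_pencilAct_lamSeq_le ΔX ΔY
    have hβ2 : √(2 * β ^ 2) = √2 * β := by
      rw [Real.sqrt_mul zero_le_two, Real.sqrt_sq hβ]
    rw [hS, hsum fun c t => pencilAct ΔX ΔY (w c) t + pencilAct ΔX ΔY (lamSeq F k c) t]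
    refine (sqrt_sum_norm_add_sq_le _ _).trans ?_
    rw [← hsum fun c => pencilAct ΔX ΔY (w c), ← hsum fun c => pencilAct ΔX ΔY (lamSeq F k c)]
    refine (add_le_add (Real.sqrt_le_sqrt hw2) (Real.sqrt_le_sqrt hl2)).trans_eq ?_
    rw [Real.sqrt_mul (by positivity), hβ2]
    ring
  have hS0 : 0 ≤ S :=
    Finset.sum_nonneg fun _ _ => Finset.sum_nonneg fun _ _ => vecNormSq_nonneg _
  have h3 : S ≤ 2 * β ^ 2 * (√E + 1) ^ 2 := by
    calc S = √S ^ 2 := (Real.sq_sqrt hS0).symm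
      _ ≤ (√2 * β * (√E + 1)) ^ 2 := by gcongr
      _ = _ := by rw [mul_pow, mul_pow, Real.sq_sqrt zero_le_two]
  refine le_of_sq_le_sq ?_ (by positivity)
  calc (sigmaMin R * √E) ^ 2 = sigmaMin R ^ 2 * E := by rw [mul_pow, Real.sq_sqrt hE0]
    _ ≤ (k : ℝ) ^ 2 / 2 * S := h1
    _ ≤ (k : ℝ) ^ 2 / 2 * (2 * β ^ 2 * (√E + 1) ^ 2) := by gcongr
    _ = _ := by ring

end

theorem le_sqrt_two_mul_of_le_mul_add_one {k s b N : ℝ} (hk : 3 ≤ k) (hs : 0 < s) (hb : 0 ≤ b)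
    (hΔ : b < s / (2 * k ^ ((3 : ℝ) / 2))) (hN : s * N ≤ k * b * (N + 1)) :
    N ≤ k * √2 / s * b ∧ k * √2 / s * b < 1 / √(2 * k) := by
  have hk0 : 0 < k := by linarith
  have hpow : k ^ ((3 : ℝ) / 2) = k * √k := by
    rw [show (3 : ℝ) / 2 = 1 + 1 / 2 by norm_num, Real.rpow_add hk0, Real.rpow_one,
      Real.sqrt_eq_rpow]
  have hr : 0 < √k := Real.sqrt_pos.2 hk0
  have hr3 : 1.732 ≤ √k := Real.le_sqrt_of_sq_le (by linarith)
  have h2 : 1.414 ≤ √2 := Real.le_sqrt_of_sq_le (by norm_num)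
  rw [hpow, lt_div_iff₀ (by positivity)] at hΔ
  have hy : 2 * √k * (k * b) < s := by linarith
  have hy0 : 0 ≤ k * b := by positivity
  set y := k * b with hy_def
  have hy3 : 3.464 * y ≤ s := by nlinarith
  have e : k * √2 / s * b = √2 * y / s := by rw [hy_def]; ring
  rw [e]
  constructor
  · rw [le_div_iff₀ hs]
    have h5 : s ≤ √2 * (s - y) := by nlinarith
    have h6 : y * s ≤ y * (√2 * (s - y)) := mul_le_mul_of_nonneg_left h5 hy0
    have h7 : (s - y) * (s * N) ≤ (s - y) * (√2 * y) := by nlinarith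
    have h8 : 0 < s - y := by linarith
    linarith [le_of_mul_le_mul_left h7 h8]
  · rw [div_lt_div_iff₀ hs (by positivity), Real.sqrt_mul zero_le_two]
    nlinarith [Real.mul_self_sqrt (zero_le_two (α := ℝ))]

/-! ### degrees and minimality of the perturbed bases -/

section

variable {k n : ℕ} {R : Matrix (Fin (k - 1) × Fin n) (Fin (k - 1) × Fin n) F}
  {ΔX ΔY : Matrix (Fin (k - 1) × Fin n) (Fin k × Fin n) F}

theorem linearIndependent_Bpencil_add_pencil (hΔ : penFrob ΔX ΔY < sigmaMin R) :
    LinearIndependent (RatFunc F) fun i => polyVec ((Bpencil R + pencil ΔX ΔY) i) := by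
  refine linearIndependent_polyVec_of_det_ne_zero loIdx ?_
  have h : (((Bpencil R + pencil ΔX ΔY).submatrix id loIdx).map (Polynomial.eval 0))
      = R + ΔY.submatrix id loIdx := by
    conv_rhs => rw [← BpencilY_submatrix R]
    rw [Bpencil_add_pencil]
    ext p q
    simp [pencil]
  rw [h]
  refine det_add_ne_zero (sigmaMin_sq_mul_le R) ?_
  have h1 := frobSq_submatrix_le ΔY (loIdx_injective (k := k) (n := n))
  have h2 := penFrob_sq ΔX ΔY
  have h3 := frobSq_nonneg ΔX
  have h4 : penFrob ΔX ΔY ^ 2 < sigmaMin R ^ 2 := by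
    have : 0 ≤ penFrob ΔX ΔY := Real.sqrt_nonneg _
    gcongr
  linarith

theorem polyVecDeg_Bpencil_add_pencil (hΔ : penFrob ΔX ΔY < sigmaMin R)
    (i : Fin (k - 1) × Fin n) : polyVecDeg ((Bpencil R + pencil ΔX ΔY) i) = 1 := by
  have hdet : (-R + ΔX.submatrix id hiIdx).det ≠ 0 := by
    refine det_add_ne_zero (s := sigmaMin R ^ 2)
      (fun x => by rw [Matrix.neg_mulVec, vecNormSq_neg]; exact sigmaMin_sq_mul_le R x) ?_
    have h1 := frobSq_submatrix_le ΔX (hiIdx_injective (k := k) (n := n))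
    have h2 := penFrob_sq ΔX ΔY
    have h3 := frobSq_nonneg ΔY
    have h4 : penFrob ΔX ΔY ^ 2 < sigmaMin R ^ 2 := by
      have : 0 ≤ penFrob ΔX ΔY := Real.sqrt_nonneg _
      gcongr
    linarith
  obtain ⟨q, hq⟩ : ∃ q, (-R + ΔX.submatrix id hiIdx) i q ≠ 0 := by
    by_contra! h
    exact hdet (Matrix.det_eq_zero_of_row_eq_zero i h)
  rw [Bpencil_add_pencil]
  refine polyVecDeg_eq_of_coeff_ne_zero (q := hiIdx q)
    (fun q => Polynomial.natDegree_linear_le) ?_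
  rw [← BpencilX_submatrix] at hq
  simpa [pencil, Polynomial.coeff_C] using hq

variable {ΔD : Matrix (Fin k × Fin n) (Fin n) F[X]}

theorem mpolyFrob_eq (hk : 0 < k) (ΔD : Matrix (Fin k × Fin n) (Fin n) F[X]) :
    mpolyFrob (k - 1) ΔD
      = √(∑ c, ∑ j ∈ Finset.range k, vecNormSq fun q => (ΔD q c).coeff j) := by
  rw [mpolyFrob, Nat.sub_add_cancel hk, Finset.sum_comm]
  simp only [vecNormSq]
  congr 1
  refine Finset.sum_congr rfl fun c _ => ?_
  rw [Finset.sum_comm]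

theorem sum_vecNormSq_coeff_lt_one (hk : 0 < k) (hD : mpolyFrob (k - 1) ΔD < 1) :
    ∑ c, ∑ j ∈ Finset.range k, vecNormSq (fun q => (ΔD q c).coeff j) < 1 := by
  rwa [mpolyFrob_eq hk, Real.sqrt_lt' one_pos, one_pow] at hD

theorem vecNormSq_one_mulVec_le {ι : Type*} [Fintype ι] [DecidableEq ι] (x : ι → F) :
    1 * vecNormSq x ≤ vecNormSq ((1 : Matrix ι ι F) *ᵥ x) := by
  rw [Matrix.one_mulVec, one_mul]

theorem eq_zero_of_Lam_add_mulVec_eq_zero (hk : 0 < k) (hD : mpolyFrob (k - 1) ΔD < 1)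
    {v : Fin k × Fin n → F[X]} (hv : (Lam F k n + ΔD)ᵀ *ᵥ v = 0) (hdeg : polyVecDeg v < 1) :
    v = 0 := by
  have hC : ∀ q, v q = Polynomial.C ((v q).coeff 0) := fun q =>
    Polynomial.eq_C_of_natDegree_le_zero (by have := natDegree_le_polyVecDeg v q; omega)
  set E : Matrix (Fin k × Fin n) (Fin k × Fin n) F :=
    Matrix.of fun p q => (ΔD q p.2).coeff (p.1.rev : ℕ) with hE
  have hfrob : frobSq E < 1 := by
    refine lt_of_eq_of_lt ?_ (sum_vecNormSq_coeff_lt_one hk hD)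
    simp only [frobSq, vecNormSq, Finset.sum_range,
      Fintype.sum_prod_type_right (f := fun p => ∑ q, ‖E p q‖ ^ 2)]
    refine Finset.sum_congr rfl fun c _ => ?_
    exact Equiv.sum_comp Fin.revPerm fun j : Fin k => ∑ q, ‖(ΔD q c).coeff (j : ℕ)‖ ^ 2
  have hone : ∀ p q : Fin k × Fin n, (1 : Matrix _ _ F) p q = lamSeq F k p.2 (p.1.rev : ℕ) q := by
    intro p q
    rw [Matrix.one_apply, lamSeq]
    refine if_congr ?_ rfl rfl
    have := p.1.isLt
    have := q.1.isLt
    rw [Prod.ext_iff, Fin.val_rev, Fin.ext_iff (a := p.1), eq_comm (a := p.2)]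
    constructor
    · rintro ⟨h1, h2⟩
      exact ⟨h2, by omega⟩
    · rintro ⟨h1, h2⟩
      exact ⟨by omega, h1⟩
  have hv0 : (fun q => (v q).coeff 0) = 0 := by
    refine eq_zero_of_add_mulVec_eq_zero vecNormSq_one_mulVec_le hfrob ?_
    funext p
    have h := congrArg (fun x => (x p.2).coeff (p.1.rev : ℕ)) hv
    simp only [Matrix.mulVec, dotProduct, Matrix.transpose_apply] at h
    rw [Polynomial.finsetSum_coeff] at h
    simp only [Matrix.mulVec, dotProduct, Pi.zero_apply, Polynomial.coeff_zero] at h ⊢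
    rw [← h]
    refine Finset.sum_congr rfl fun q _ => ?_
    conv_rhs => rw [hC q]
    rw [Polynomial.coeff_mul_C, Matrix.add_apply, Matrix.add_apply, Polynomial.coeff_add,
      coeff_Lam, hone]
    rfl
  funext q
  rw [hC q, show (v q).coeff 0 = 0 from congrFun hv0 q, Polynomial.C_0]
  rfl

theorem linearIndependent_Lam_add (hk : 0 < k) (hD : mpolyFrob (k - 1) ΔD < 1) :
    LinearIndependent (RatFunc F) fun c => polyVec ((Lam F k n + ΔD)ᵀ c) := by
  set f : Fin n → Fin k × Fin n := fun c => (⟨k - 1, by omega⟩, c) with hf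
  have hinj : Function.Injective f := fun c c' h => congrArg Prod.snd h
  refine linearIndependent_polyVec_of_det_ne_zero f ?_
  set E : Matrix (Fin n) (Fin k × Fin n) F := Matrix.of fun c q => (ΔD q c).coeff 0 with hE
  have h : (((Lam F k n + ΔD)ᵀ.submatrix id f).map (Polynomial.eval 0))
      = 1 + E.submatrix id f := by
    ext c c'
    simp only [Matrix.map_apply, Matrix.submatrix_apply, Matrix.transpose_apply,
      Matrix.add_apply, ← Polynomial.coeff_zero_eq_eval_zero, Polynomial.coeff_add, coeff_Lam]
    congr 1
    simp [lamSeq, hf, Matrix.one_apply, eq_comm]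
  rw [h]
  refine det_add_ne_zero vecNormSq_one_mulVec_le
    (((frobSq_submatrix_le E hinj).trans ?_).trans_lt (sum_vecNormSq_coeff_lt_one hk hD))
  refine Finset.sum_le_sum fun c _ => ?_
  exact Finset.single_le_sum (f := fun j => vecNormSq fun q => (ΔD q c).coeff j)
    (fun _ _ => vecNormSq_nonneg _) (Finset.mem_range.2 hk)

theorem dualMinBases_of_mul_eq_zero (hk : 0 < k) (hΔ : (k : ℝ) * penFrob ΔX ΔY < sigmaMin R)
    (hD : mpolyFrob (k - 1) ΔD < 1)
    (hmul : (Bpencil R + pencil ΔX ΔY) * (Lam F k n + ΔD) = 0)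
    (hdeg : ∀ c, polyVecDeg ((Lam F k n + ΔD)ᵀ c) = k - 1) :
    DualMinBases (Bpencil R + pencil ΔX ΔY) (Lam F k n + ΔD)ᵀ := by
  have hΔ1 : penFrob ΔX ΔY < sigmaMin R := by
    have h1 : (1 : ℝ) ≤ k := by exact_mod_cast hk
    have h2 : 0 ≤ penFrob ΔX ΔY := Real.sqrt_nonneg _
    nlinarith
  refine ⟨?_, ?_, ?_, by rwa [Matrix.transpose_transpose]⟩
  · refine isMinimalBasisMat_of_le_polyVecDeg (linearIndependent_Bpencil_add_pencil hΔ1)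
      (polyVecDeg_Bpencil_add_pencil hΔ1) fun v hv hv0 => ?_
    by_contra! h
    refine hv0 (eq_zero_of_Lam_add_mulVec_eq_zero hk hD ?_ h)
    exact mulVec_eq_zero_of_mem_rowSpan (by rwa [Matrix.transpose_transpose]) hv
  · refine isMinimalBasisMat_of_le_polyVecDeg (linearIndependent_Lam_add hk hD)
      hdeg fun v hv hv0 => ?_
    by_contra! h
    have hM : (Bpencil R + pencil ΔX ΔY) *ᵥ v = 0 :=
      mulVec_eq_zero_of_mem_rowSpan
        (by rw [← Matrix.transpose_mul, hmul, Matrix.transpose_zero]) hv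
    have hcoeff : ∀ j, k - 1 ≤ j → ∀ q, (v q).coeff j = 0 := fun j hj q =>
      Polynomial.coeff_eq_zero_of_natDegree_lt
        (((natDegree_le_polyVecDeg v q).trans_lt h).trans_le hj)
    have hw : (fun j q => (v q).coeff j) = 0 := by
      refine eq_zero_of_pencilAct_eq_zero hk hΔ (fun j hj => funext fun q => ?_) (fun c => ?_)
        fun t _ => ?_
      · exact hcoeff j (by omega) q
      · exact hcoeff _ le_rfl _
      · funext p
        rw [← coeff_pencil_mulVec, ← Bpencil_add_pencil, hM]
        rfl
    refine hv0 (funext fun q => Polynomial.ext fun j => ?_)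
    exact congrFun (congrFun hw j) q
  · obtain ⟨m, rfl⟩ : ∃ m, k = m + 1 := ⟨k - 1, by omega⟩
    simp [add_mul]

end

/-- Let `k > 2`, `R̃` nonsingular, `B(λ) = λ[0 ∣ −R̃] + [R̃ ∣ 0]`. If
`ΔB(λ) = λ ΔX + ΔY` satisfies `‖ΔB‖_F < σ_min(R̃)/(2k^{3/2})`, then there is a matrix
polynomial `ΔD(λ) ∈ F[λ]^{kn×n}` of grade `k−1` such that (a) `B + ΔB` and
`(Λ_k(λ)⊗I_n)ᵀ + ΔD(λ)ᵀ` are dual minimal bases with all row degrees `1` and `k−1`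
respectively, and (b) `‖ΔD‖_F ≤ (k√2/σ_min(R̃))‖ΔB‖_F < 1/√(2k)`. -/
theorem statement_16 {F : Type*} [RCLike F] {k n : ℕ} (hk : 2 < k)
    (R : Matrix (Fin (k - 1) × Fin n) (Fin (k - 1) × Fin n) F) (hR : IsUnit R)
    (ΔX ΔY : Matrix (Fin (k - 1) × Fin n) (Fin k × Fin n) F)
    (hΔ : penFrob ΔX ΔY < sigmaMin R / (2 * (k : ℝ) ^ ((3 : ℝ) / 2))) :
    ∃ ΔD : Matrix (Fin k × Fin n) (Fin n) F[X],
      (∀ p c, (ΔD p c).natDegree ≤ k - 1) ∧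
      DualMinBases (Bpencil R + pencil ΔX ΔY) (Lam F k n + ΔD)ᵀ ∧
      (∀ i, polyVecDeg ((Bpencil R + pencil ΔX ΔY) i) = 1) ∧
      (∀ c, polyVecDeg ((Lam F k n + ΔD)ᵀ c) = k - 1) ∧
      mpolyFrob (k - 1) ΔD ≤ (k : ℝ) * Real.sqrt 2 / sigmaMin R * penFrob ΔX ΔY ∧
      mpolyFrob (k - 1) ΔD < 1 / Real.sqrt (2 * (k : ℝ)) := by
  have hk0 : 0 < k := by omega
  have hk3 : (3 : ℝ) ≤ k := by exact_mod_cast hk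
  set β := penFrob ΔX ΔY with hβ_def
  have hβ : 0 ≤ β := Real.sqrt_nonneg _
  have hσ : 0 < sigmaMin R := by
    by_contra h
    rw [le_antisymm (not_lt.1 h) (sigmaMin_nonneg R), zero_div] at hΔ
    exact absurd hΔ (not_lt.2 hβ)
  have hkβ : (k : ℝ) * β < sigmaMin R := by
    have hpow : (k : ℝ) ≤ 2 * (k : ℝ) ^ ((3 : ℝ) / 2) := by
      have h := Real.rpow_le_rpow_of_exponent_le (x := k) (by linarith)
        (show (1 : ℝ) ≤ 3 / 2 by norm_num)
      rw [Real.rpow_one] at h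
      linarith
    rw [lt_div_iff₀ (by positivity)] at hΔ
    nlinarith
  choose d hd hd0 hact using fun c : Fin n =>
    exists_pencilAct_eq_zero (R := R) (ΔX := ΔX) (ΔY := ΔY) hk0 hkβ
      fun c' => if c' = c then 1 else 0
  set D : Matrix (Fin k × Fin n) (Fin n) F[X] := Matrix.of fun q c =>
    ∑ j ∈ Finset.range k, Polynomial.C (d c j q) * Polynomial.X ^ j with hD
  have hDcoeff : ∀ q c j, (D q c).coeff j = d c j q := fun q c j => by
    by_cases h : j < k
    · simp [hD, Polynomial.finsetSum_coeff, h]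
    · simp [hD, Polynomial.finsetSum_coeff, h, hd c j (not_lt.1 h)]
  have hsum : Lam F k n + (D - Lam F k n) = D := add_sub_cancel _ _
  have hcoeff : ∀ q c j, ((D - Lam F k n) q c).coeff j = (d c - lamSeq F k c) j q :=
    fun q c j => by
      rw [Matrix.sub_apply, Polynomial.coeff_sub, hDcoeff, coeff_Lam]
      rfl
  have hw : ∀ c j, k ≤ j → (d c - lamSeq F k c) j = 0 := fun c j hj => by
    rw [Pi.sub_apply, hd c j hj, lamSeq_eq_zero c hj, sub_zero]
  have hdegD : ∀ q c, (D q c).natDegree ≤ k - 1 := fun q c =>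
    Polynomial.natDegree_le_iff_coeff_eq_zero.2 fun j hj => by
      rw [hDcoeff, hd c j (by omega)]
      rfl
  have hN := sigmaMin_mul_sqrt_le (R := R) (ΔX := ΔX) (ΔY := ΔY) hk0 hw
    (fun c c' => by simp [hd0, lamSeq]) fun c t => by rw [sub_add_cancel, hact]
  have hfrob : mpolyFrob (k - 1) (D - Lam F k n)
      = √(∑ c, ∑ j ∈ Finset.range k, vecNormSq ((d c - lamSeq F k c) j)) := by
    rw [mpolyFrob_eq hk0]
    simp only [hcoeff]
  rw [← hfrob] at hN
  obtain ⟨hle, hlt⟩ := le_sqrt_two_mul_of_le_mul_add_one hk3 hσ hβ hΔ hN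
  have hone : mpolyFrob (k - 1) (D - Lam F k n) < 1 := by
    refine (hle.trans_lt hlt).trans_le ?_
    rw [div_le_one (by positivity)]
    exact Real.one_le_sqrt.2 (by linarith)
  have hmul : (Bpencil R + pencil ΔX ΔY) * D = 0 := by
    rw [Bpencil_add_pencil]
    ext p c t
    refine (coeff_pencil_mulVec _ _ (fun q => D q c) t p).trans ?_
    simp only [hDcoeff]
    exact congrFun (hact c t) p
  have hdeg : ∀ c, polyVecDeg (Dᵀ c) = k - 1 := fun c =>
    polyVecDeg_eq_of_coeff_ne_zero (q := (⟨0, hk0⟩, c)) (fun q => hdegD q c) (by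
      rw [Matrix.transpose_apply, hDcoeff, hd0, if_pos rfl]
      exact one_ne_zero)
  refine ⟨D - Lam F k n, fun q c => ?_, ?_, polyVecDeg_Bpencil_add_pencil ?_, ?_, hle,
    hle.trans_lt hlt⟩
  · refine Polynomial.natDegree_le_iff_coeff_eq_zero.2 fun j hj => ?_
    rw [hcoeff, hw c j (by omega)]
    rfl
  · exact dualMinBases_of_mul_eq_zero hk0 hkβ hone (by rwa [hsum]) (by rwa [hsum])
  · nlinarith
  · rwa [hsum]
end GLin
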